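/- Let Assumption S* hold, let Assumption B̲_{{α_n}} hold for a sequence α_n ↑ 1, and let Assumptions LEC_{{α_n}}(ii) and LEC_{{α_n}}(iii) be satisfied for this sequence. Then there exists a deterministic policy φ such that the average-cost optimality equation (ACOE) holds with the function u(x) := lim_{n→∞} u_{α_n}(x): for all x ∈ X, w* + u(x) = c(x,φ(x)) + ∫_X u(y) q(dy|x,φ(x)) = min_{a∈A} [ c(x,a) + ∫_X u(y) q(dy|x,a) ]. -/

import Mathlib

open MeasureTheory ProbabilityTheory Filter Topology Set
open scoped ENNReal NNReal

noncomputable section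

/-- The nonnegative part of an extended real, as an element of `ℝ≥0∞`. -/
def eToENN (x : EReal) : ℝ≥0∞ := if x = ⊤ then ⊤ else ENNReal.ofReal x.toReal

/-- Extended integral of an `EReal`-valued function: positive part minus negative part. -/
def eInt {Y : Type*} [MeasurableSpace Y] (μ : Measure Y) (f : Y → EReal) : EReal :=
  ((∫⁻ y, eToENN (f y) ∂μ : ℝ≥0∞) : EReal) - ((∫⁻ y, eToENN (-(f y)) ∂μ : ℝ≥0∞) : EReal)

/-- Extended sum of an `EReal`-valued series: positive part minus negative part. -/
def eSum (f : ℕ → EReal) : EReal :=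
  ((∑' t, eToENN (f t) : ℝ≥0∞) : EReal) - ((∑' t, eToENN (-(f t)) : ℝ≥0∞) : EReal)

/-- Histories of length `t`: `(X × A) ^ t × X`. -/
abbrev Hist (X A : Type*) (t : ℕ) := (Fin t → X × A) × X

/-- A (randomized, history-dependent) policy: a regular transition probability from
histories to actions, at every time epoch. -/
structure Policy (X A : Type*) [MeasurableSpace X] [MeasurableSpace A] where
  π : ∀ t : ℕ, Kernel (Hist X A t) A
  markov : ∀ t, IsMarkovKernel (π t)

/-- A Markov decision process with state space `X`, action space `A`, one-step cost `c`
(measurable and bounded below, with values in `(-∞, +∞]`) and transition probability `q`. -/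
structure MDP (X A : Type*) [MeasurableSpace X] [MeasurableSpace A] where
  c : X → A → EReal
  q : Kernel (X × A) X
  markov : IsMarkovKernel q
  c_meas : Measurable fun p : X × A => c p.1 p.2
  c_ne_bot : ∃ K : ℝ, ∀ x a, (K : EReal) ≤ c x a

variable {X A : Type*} [MeasurableSpace X] [MeasurableSpace A]

/-- The deterministic policy given by a measurable map `φ : X → A` applied to the current state. -/
def detPolicy (φ : X → A) (hφ : Measurable φ) : Policy X A :=
  ⟨fun t => Kernel.deterministic (fun h : Hist X A t => φ h.2) (hφ.comp measurable_snd),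
   fun _ => by infer_instance⟩

/-- The distribution `P_x^π` of the history `h_t`, constructed recursively
(Ionescu-Tulcea finite-dimensional marginals). -/
def histMeas (M : MDP X A) (p : Policy X A) (x : X) : ∀ t : ℕ, Measure (Hist X A t)
  | 0 => Measure.dirac (Fin.elim0, x)
  | (t + 1) =>
      (histMeas M p x t).bind fun h =>
        ((p.π t) h).bind fun a =>
          (M.q (h.2, a)).map fun x' => (Fin.snoc h.1 (h.2, a), x')

/-- The joint distribution of the state-action pair `(x_t, a_t)` under `P_x^π`. -/
def saMeas (M : MDP X A) (p : Policy X A) (x : X) (t : ℕ) : Measure (X × A) :=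
  (histMeas M p x t).bind fun h => ((p.π t) h).map fun a => (h.2, a)

/-- `E_x^π c(x_t, a_t)`. -/
def expCost (M : MDP X A) (p : Policy X A) (x : X) (t : ℕ) : EReal :=
  eInt (saMeas M p x t) fun sa => M.c sa.1 sa.2

/-- The expected total discounted cost `v_α^π(x) = E_x^π ∑_t α^t c(x_t, a_t)`. -/
def vDisc (M : MDP X A) (α : ℝ) (p : Policy X A) (x : X) : EReal :=
  eSum fun t => ((α ^ t : ℝ) : EReal) * expCost M p x t

/-- The finite-horizon expected total (undiscounted) cost `v_{N,1}^π(x)`. -/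
def vFin (M : MDP X A) (N : ℕ) (p : Policy X A) (x : X) : EReal :=
  ∑ t ∈ Finset.range N, expCost M p x t

/-- The discounted value function `v_α(x) = inf_π v_α^π(x)`. -/
def vDiscOpt (M : MDP X A) (α : ℝ) (x : X) : EReal :=
  ⨅ p : Policy X A, vDisc M α p x

/-- The average cost per unit time `w^π(x)`. -/
def avgCost (M : MDP X A) (p : Policy X A) (x : X) : EReal :=
  Filter.limsup (fun N : ℕ => (((N : ℝ)⁻¹ : ℝ) : EReal) * vFin M N p x) atTop

/-- The optimal average cost `w(x) = inf_π w^π(x)`. -/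
def avgOpt (M : MDP X A) (x : X) : EReal :=
  ⨅ p : Policy X A, avgCost M p x

/-- `w* = inf_x w(x)`. -/
def wStar (M : MDP X A) : EReal := ⨅ x : X, avgOpt M x

/-- `m_α = inf_x v_α(x)`. -/
def mDisc (M : MDP X A) (α : ℝ) : EReal := ⨅ x : X, vDiscOpt M α x

/-- The discounted relative value function `u_α(x) = v_α(x) - m_α`. -/
def uDisc (M : MDP X A) (α : ℝ) (x : X) : EReal := vDiscOpt M α x - mDisc M α

/-- `w̄ = limsup_{α↑1} (1-α) m_α`. -/
def wBar (M : MDP X A) : EReal :=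
  Filter.limsup (fun α : ℝ => ((1 - α : ℝ) : EReal) * mDisc M α) (𝓝[Set.Ico (0:ℝ) 1] 1)

/-- `w̲ = liminf_{α↑1} (1-α) m_α`. -/
def wLow (M : MDP X A) : EReal :=
  Filter.liminf (fun α : ℝ => ((1 - α : ℝ) : EReal) * mDisc M α) (𝓝[Set.Ico (0:ℝ) 1] 1)

/-- `w̄_{{α_n}} = limsup_n (1-α_n) m_{α_n}`. -/
def wBarSeq (M : MDP X A) (a : ℕ → ℝ) : EReal :=
  Filter.limsup (fun n : ℕ => ((1 - a n : ℝ) : EReal) * mDisc M (a n)) atTop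

/-- `w̲_{{α_n}} = liminf_n (1-α_n) m_{α_n}`. -/
def wLowSeq (M : MDP X A) (a : ℕ → ℝ) : EReal :=
  Filter.liminf (fun n : ℕ => ((1 - a n : ℝ) : EReal) * mDisc M (a n)) atTop


section TopologicalAssumptions

variable {X A : Type*} [MetricSpace X] [TopologicalSpace.SeparableSpace X]
  [MeasurableSpace X] [BorelSpace X] [StandardBorelSpace X]
  [MetricSpace A] [TopologicalSpace.SeparableSpace A]
  [MeasurableSpace A] [BorelSpace A] [StandardBorelSpace A]

/-- Assumption W*(i): the cost `c` is `K`-inf-compact, i.e., for every nonempty compact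
`K ⊆ X`, the restriction of `c` to `K × A` has compact sublevel sets. -/
def AssumptionWi (M : MDP X A) : Prop :=
  ∀ K : Set X, K.Nonempty → IsCompact K →
    ∀ lam : ℝ, IsCompact {p : X × A | p.1 ∈ K ∧ M.c p.1 p.2 ≤ (lam : EReal)}

/-- Assumption W*(ii): the transition probability `q(·|x,a)` is weakly continuous in `(x,a)`. -/
def AssumptionWii (M : MDP X A) : Prop :=
  ∀ f : BoundedContinuousFunction X ℝ, Continuous fun p : X × A => ∫ y, f y ∂ (M.q p)

/-- Assumption S*(i): for each `x`, the function `a ↦ c(x,a)` has compact sublevel sets. -/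
def AssumptionSi (M : MDP X A) : Prop :=
  ∀ x : X, ∀ lam : ℝ, IsCompact {a : A | M.c x a ≤ (lam : EReal)}

/-- Assumption S*(ii): for each `x`, the transition probability `q(·|x,a)` is setwise
continuous in `a`. -/
def AssumptionSii (M : MDP X A) : Prop :=
  ∀ x : X, ∀ B : Set X, MeasurableSet B → Continuous fun a : A => M.q (x, a) B

end TopologicalAssumptions

section Statements

variable {X A : Type*} [MetricSpace X] [TopologicalSpace.SeparableSpace X]
  [MeasurableSpace X] [BorelSpace X] [StandardBorelSpace X]
  [MetricSpace A] [TopologicalSpace.SeparableSpace A]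
  [MeasurableSpace A] [BorelSpace A] [StandardBorelSpace A]

/-- The pointwise limit `u(x) = lim_{n→∞} u_{α_n}(x)` (realized as a lower limit,
which equals the limit whenever the latter exists). -/
def uPointwise (M : MDP X A) (a : ℕ → ℝ) (x : X) : EReal :=
  Filter.liminf (fun n : ℕ => uDisc M (a n) x) atTop

/-- A sequence of sets is contained, termwise, in a sequence of measurable sets with empty
intersection. -/
def JointlySeparable {α : Type*} [MeasurableSpace α] (S : ℕ → Set α) : Prop :=
  ∃ B : ℕ → Set α, (∀ n, MeasurableSet (B n)) ∧ (∀ n, S n ⊆ B n) ∧ ⋂ n, B n = ∅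

theorem JointlySeparable.mono {α : Type*} [MeasurableSpace α] {S T : ℕ → Set α}
    (hT : JointlySeparable T) (h : ∀ n, S n ⊆ T n) : JointlySeparable S := by
  obtain ⟨B, hB, hTB, hi⟩ := hT
  exact ⟨B, hB, fun n => (h n).trans (hTB n), hi⟩

theorem JointlySeparable.of_iUnion {α : Type*} [MeasurableSpace α] {S : ℕ → Set α} (i : ℕ)
    {T : ℕ → Set α} (hS : S i ⊆ ⋃ m, T m)
    (h : ∀ m, JointlySeparable (Function.update S i (T m))) : JointlySeparable S := by
  choose B hBm hSB hBi using h
  refine ⟨Function.update (fun n => ⋂ m, B m n) i (⋃ m, B m i), fun n => ?_, fun n => ?_, ?_⟩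
  · rcases eq_or_ne n i with rfl | hn
    · simpa using MeasurableSet.iUnion fun m => hBm m n
    · simpa [hn] using MeasurableSet.iInter fun m => hBm m n
  · rcases eq_or_ne n i with rfl | hn
    · simp only [Function.update_self]
      refine hS.trans (iUnion_mono fun m => ?_)
      simpa using hSB m n
    · simp only [Function.update_of_ne hn]
      refine subset_iInter fun m => ?_
      simpa [hn] using hSB m n
  · rw [eq_empty_iff_forall_notMem]
    intro x hx
    rw [mem_iInter] at hx
    have hxi := hx i
    simp only [Function.update_self, mem_iUnion] at hxi
    obtain ⟨m, hm⟩ := hxi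
    have : x ∈ ⋂ n, B m n := by
      refine mem_iInter.2 fun n => ?_
      rcases eq_or_ne n i with rfl | hn
      · exact hm
      · have := hx n
        simp only [Function.update_of_ne hn, mem_iInter] at this
        exact this m
    rw [hBi m] at this
    exact this

theorem jointlySeparable_of_disjoint {α : Type*} [MeasurableSpace α] {S : ℕ → Set α} {i j : ℕ}
    {U V : Set α} (hU : MeasurableSet U) (hV : MeasurableSet V) (hSU : S i ⊆ U) (hSV : S j ⊆ V)
    (hd : Disjoint U V) : JointlySeparable S := by
  classical
  refine ⟨fun n => (if n = i then U else univ) ∩ (if n = j then V else univ), fun n => ?_,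
    fun n => ?_, ?_⟩
  · refine MeasurableSet.inter ?_ ?_ <;> split_ifs <;> first | assumption | exact .univ
  · refine subset_inter ?_ ?_ <;> split_ifs with h <;> simp_all
  · rw [eq_empty_iff_forall_notMem]
    intro x hx
    rw [mem_iInter] at hx
    have h1 := (hx i).1
    have h2 := (hx j).2
    simp only [if_true] at h1 h2
    exact disjoint_left.1 hd h1 h2

/-- The `n`-th section, at stage `k`, of the box of sequences of sequences whose first `k`
coordinates, enumerated by the pairing function, are given by `w`. -/
def pairCylinder (k : ℕ) (w : ℕ → ℕ) (n : ℕ) : Set (ℕ → ℕ) :=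
  {y | ∀ i, Nat.pair n i < k → y i = w (Nat.pair n i)}

theorem pairCylinder_congr {k : ℕ} {w w' : ℕ → ℕ} (h : ∀ j < k, w j = w' j) (n : ℕ) :
    pairCylinder k w n = pairCylinder k w' n := by
  ext y
  exact forall₂_congr fun i hi => by rw [h _ hi]

theorem jointlySeparable_range {α : Type*} [TopologicalSpace α] [T2Space α] [MeasurableSpace α]
    [OpensMeasurableSpace α] {f : ℕ → (ℕ → ℕ) → α} (hf : ∀ n, Continuous (f n))
    (h : ⋂ n, range (f n) = ∅) : JointlySeparable fun n => range (f n) := by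
  by_contra hsep
  have step : ∀ (k : ℕ) (w : ℕ → ℕ), ¬ JointlySeparable (fun n => f n '' pairCylinder k w n) →
      ∃ m, ¬ JointlySeparable
        (fun n => f n '' pairCylinder (k + 1) (Function.update w k m) n) := by
    intro k w
    contrapose!
    intro H
    refine JointlySeparable.of_iUnion (Nat.unpair k).1 (T := fun m => f (Nat.unpair k).1 ''
      pairCylinder (k + 1) (Function.update w k m) (Nat.unpair k).1) ?_ fun m => ?_
    · rintro _ ⟨y, hy, rfl⟩
      refine mem_iUnion.2 ⟨y (Nat.unpair k).2, y, fun i hi => ?_, rfl⟩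
      rcases (Nat.lt_succ_iff_lt_or_eq.1 hi) with hi | hi
      · rw [Function.update_of_ne hi.ne, hy i hi]
      · rw [hi, Function.update_self, ← hi, Nat.unpair_pair]
    · refine (H m).mono fun n => ?_
      rcases eq_or_ne n (Nat.unpair k).1 with rfl | hn
      · simp
      · simp only [Function.update_of_ne hn]
        refine image_mono fun y hy i hi => ?_
        have hne : Nat.pair n i ≠ k := by
          rintro rfl
          simp at hn
        rw [Function.update_of_ne hne]
        exact hy i (by omega)
  choose! m hm using step
  let W : ℕ → ℕ → ℕ := fun k => Nat.rec (fun _ => 0) (fun k w => Function.update w k (m k w)) k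
  have hW : ∀ k, W (k + 1) = Function.update (W k) k (m k (W k)) := fun k => rfl
  have hnot : ∀ k, ¬ JointlySeparable (fun n => f n '' pairCylinder k (W k) n) := by
    intro k
    induction k with
    | zero => simpa [pairCylinder, image_univ] using hsep
    | succ k ih => rw [hW]; exact hm k _ ih
  let w : ℕ → ℕ := fun j => W (j + 1) j
  have hw : ∀ k, ∀ j < k, W k j = w j := by
    intro k
    induction k with
    | zero => simp
    | succ k ih =>
      intro j hj
      rcases (Nat.lt_succ_iff_lt_or_eq.1 hj) with hj | rfl
      · rw [hW, Function.update_of_ne hj.ne, ih j hj]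
      · rfl
  let y : ℕ → ℕ → ℕ := fun n i => w (Nat.pair n i)
  obtain ⟨i, j, hij⟩ : ∃ i j, f i (y i) ≠ f j (y j) := by
    by_contra! hall
    have : f 0 (y 0) ∈ ⋂ n, range (f n) := mem_iInter.2 fun n => ⟨y n, hall n 0⟩
    rw [h] at this
    exact this
  obtain ⟨U, V, hU, hV, hiU, hjV, hd⟩ := t2_separation hij
  have key : ∀ (n : ℕ) (O : Set α), IsOpen O → f n (y n) ∈ O →
      ∃ k, ∀ k' ≥ k, f n '' pairCylinder k' w n ⊆ O := by
    intro n O hO hn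
    have hnhds : f n ⁻¹' O ∈ 𝓝 (y n) := (hf n).continuousAt.preimage_mem_nhds (hO.mem_nhds hn)
    rw [nhds_pi, Filter.mem_pi] at hnhds
    obtain ⟨I, hI, t, ht, hsub⟩ := hnhds
    obtain ⟨b, hb⟩ := (hI.image (Nat.pair n)).bddAbove
    refine ⟨b + 1, fun k' hk' => ?_⟩
    rintro _ ⟨z, hz, rfl⟩
    refine hsub fun l hl => ?_
    have : Nat.pair n l ≤ b := hb (mem_image_of_mem _ hl)
    rw [hz l (by omega)]
    exact mem_of_mem_nhds (ht l)
  obtain ⟨k, hk⟩ := key i U hU hiU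
  obtain ⟨k', hk'⟩ := key j V hV hjV
  refine hnot (max k k') ?_
  have : (fun n => f n '' pairCylinder (max k k') (W (max k k')) n)
      = fun n => f n '' pairCylinder (max k k') w n := by
    funext n
    rw [pairCylinder_congr (hw _)]
  rw [this]
  exact jointlySeparable_of_disjoint hU.measurableSet hV.measurableSet (hk _ (le_max_left _ _))
    (hk' _ (le_max_right _ _)) hd

/-- **Novikov's separation theorem**. -/
theorem jointlySeparable_of_analyticSet {α : Type*} [TopologicalSpace α] [T2Space α]
    [MeasurableSpace α] [OpensMeasurableSpace α] {S : ℕ → Set α} (hS : ∀ n, AnalyticSet (S n))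
    (h : ⋂ n, S n = ∅) : JointlySeparable S := by
  by_cases hne : ∃ n, S n = ∅
  · obtain ⟨n, hn⟩ := hne
    exact jointlySeparable_of_disjoint (i := n) (j := n) .empty .empty hn.subset hn.subset
      (disjoint_empty _)
  · push Not at hne
    have : ∀ n, ∃ f : (ℕ → ℕ) → α, Continuous f ∧ range f = S n := by
      intro n
      have := hS n
      rw [AnalyticSet] at this
      exact this.resolve_left (hne n).ne_empty
    choose f hf hr using this
    have hSf : S = fun n => range (f n) := funext fun n => (hr n).symm
    rw [hSf] at h ⊢
    exact jointlySeparable_range hf h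

/-- The projection of a Borel set with closed sections along a compact space is Borel. -/
theorem measurableSet_image_fst_of_isClosed {X Z : Type*} [MeasurableSpace X]
    [StandardBorelSpace X] [TopologicalSpace Z] [PolishSpace Z] [CompactSpace Z]
    [MeasurableSpace Z] [BorelSpace Z] {B : Set (X × Z)} (hB : MeasurableSet B)
    (hc : ∀ x, IsClosed {z | (x, z) ∈ B}) : MeasurableSet (Prod.fst '' B) := by
  let := upgradeStandardBorel X
  obtain ⟨V, hV⟩ := ((TopologicalSpace.countable_countableBasis Z).insert ∅).exists_eq_range
    (insert_nonempty _ _)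
  have hVo : ∀ n, IsOpen (V n) := by
    intro n
    have : V n ∈ insert ∅ (TopologicalSpace.countableBasis Z) := hV ▸ mem_range_self n
    rcases this with h | h
    · rw [h]; exact isOpen_empty
    · exact TopologicalSpace.isOpen_of_mem_countableBasis h
  let S : ℕ → Set (X × Z) := fun n => (fun p : X × Z × Z => (p.1, p.2.1)) ''
    {p | (p.1, p.2.1) ∉ B ∧ ((p.1, p.2.2) ∈ B ∧ p.2.2 ∈ V n ∨ p.2.1 ∉ V n)}
  have hSa : ∀ n, AnalyticSet (S n) := by
    intro n
    have m1 : Measurable fun p : X × Z × Z => (p.1, p.2.1) := by fun_prop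
    have m2 : Measurable fun p : X × Z × Z => (p.1, p.2.2) := by fun_prop
    have m3 : Measurable fun p : X × Z × Z => p.2.2 := by fun_prop
    have m4 : Measurable fun p : X × Z × Z => p.2.1 := by fun_prop
    refine MeasurableSet.analyticSet_image ?_ m1
    exact (m1 hB).compl.inter (((m2 hB).inter (m3 (hVo n).measurableSet)).union
      (m4 (hVo n).measurableSet).compl)
  have hPa : ∀ n, AnalyticSet (Prod.fst '' (B ∩ Prod.snd ⁻¹' V n)) := fun n =>
    (hB.inter (measurable_snd (hVo n).measurableSet)).analyticSet_image measurable_fst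
  have hSi : ⋂ n, S n = ∅ := by
    rw [eq_empty_iff_forall_notMem]
    rintro ⟨x, z⟩ hx
    rw [mem_iInter] at hx
    have hxz : (x, z) ∉ B := by
      obtain ⟨p, hp, he⟩ := hx 0
      exact he ▸ hp.1
    obtain ⟨v, hv, hzv, hvs⟩ := (TopologicalSpace.isBasis_countableBasis Z).exists_subset_of_mem_open
      (show z ∈ {z | (x, z) ∈ B}ᶜ from hxz) (hc x).isOpen_compl
    have : v ∈ range V := hV ▸ mem_insert_of_mem _ hv
    obtain ⟨n, rfl⟩ := this
    obtain ⟨⟨x', z', y⟩, ⟨-, hp⟩, he⟩ := hx n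
    simp only [Prod.mk.injEq] at he
    obtain ⟨rfl, rfl⟩ := he
    rcases hp with ⟨h1, h2⟩ | h
    · exact hvs h2 h1
    · exact h hzv
  obtain ⟨D, hDm, hSD, hDi⟩ := jointlySeparable_of_analyticSet hSa hSi
  have hQa : ∀ n, AnalyticSet (Prod.fst '' (Bᶜ \ D n)) := fun n =>
    (hB.compl.diff (hDm n)).analyticSet_image measurable_fst
  have hd : ∀ n, Disjoint (Prod.fst '' (Bᶜ \ D n)) (Prod.fst '' (B ∩ Prod.snd ⁻¹' V n)) := by
    intro n
    rw [disjoint_left]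
    rintro _ ⟨⟨x, z⟩, ⟨h1, h2⟩, rfl⟩ ⟨⟨x', y⟩, ⟨h3, h4⟩, rfl⟩
    exact h2 (hSD n ⟨(x', z, y), ⟨h1, Or.inl ⟨h3, h4⟩⟩, rfl⟩)
  choose C hQC hPC hCm using fun n => (hQa n).measurablySeparable (hPa n) (hd n)
  have hcompl : (Prod.fst '' B)ᶜ =
      ⋃ F : Finset ℕ, ⋃ _ : ⋃ n ∈ F, V n = univ, ⋂ n ∈ F, C n := by
    ext x
    simp only [mem_compl_iff, mem_iUnion, mem_iInter, exists_prop]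
    constructor
    · intro hx
      have hx' : ∀ z, (x, z) ∉ B := fun z hz => hx ⟨_, hz, rfl⟩
      have hcov : (univ : Set Z) ⊆ ⋃ n : {n // x ∈ C n}, V n := by
        intro z _
        have : (x, z) ∉ ⋂ n, D n := by rw [hDi]; exact notMem_empty _
        rw [mem_iInter, not_forall] at this
        obtain ⟨n, hn⟩ := this
        refine mem_iUnion.2 ⟨⟨n, hQC n ⟨(x, z), ⟨hx' z, hn⟩, rfl⟩⟩, ?_⟩
        by_contra hz
        exact hn (hSD n ⟨(x, z, z), ⟨hx' z, Or.inr hz⟩, rfl⟩)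
      obtain ⟨F, hF⟩ := isCompact_univ.elim_finite_subcover _ (fun n => hVo _) hcov
      classical
      refine ⟨F.image Subtype.val, ?_, ?_⟩
      · refine univ_subset_iff.1 (hF.trans ?_)
        simp only [Finset.set_biUnion_finset_image]
        exact subset_rfl
      · intro n hn
        obtain ⟨m, -, rfl⟩ := Finset.mem_image.1 hn
        exact m.2
    · rintro ⟨F, hF, hx⟩ ⟨⟨x', z⟩, hz, rfl⟩
      have : z ∈ ⋃ n ∈ F, V n := hF ▸ mem_univ z
      simp only [mem_iUnion, exists_prop] at this
      obtain ⟨n, hn, hzn⟩ := this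
      exact disjoint_left.1 (hPC n) ⟨(x', z), ⟨hz, hzn⟩, rfl⟩ (hx n hn)
  refine MeasurableSet.of_compl ?_
  rw [hcompl]
  exact .iUnion fun F => .iUnion fun _ => .biInter F.countable_toSet fun n _ => hCm n

/-- Nonempty sublevel sets of an increasing sequence of functions with compact sublevel sets, at
decreasing levels, have a common point. -/
theorem exists_forall_le_of_isCompact {A : Type*} [TopologicalSpace A] [T2Space A]
    {g : ℕ → A → ℝ≥0∞} {r : ℕ → ℝ≥0∞} (hg : Monotone g) (hr : Antitone r)
    (hc : ∀ k, IsCompact {z | g k z ≤ r k}) (hne : ∀ k, ∃ z, g k z ≤ r k) :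
    ∃ z, ∀ k, g k z ≤ r k := by
  obtain ⟨z, hz⟩ := IsCompact.nonempty_iInter_of_sequence_nonempty_isCompact_isClosed
    (fun k => {z | g k z ≤ r k})
    (fun k z hz => (hg k.le_succ z).trans (le_trans hz (hr k.le_succ)))
    hne (hc 0) fun k => (hc k).isClosed
  exact ⟨z, fun k => mem_iInter.1 hz k⟩

/-- A function with compact sublevel sets attains its infimum. -/
theorem exists_eq_iInf_of_isCompact {A : Type*} [TopologicalSpace A] [T2Space A] [Nonempty A]
    {f : A → ℝ≥0∞} (hc : ∀ r, r ≠ ⊤ → IsCompact {z | f z ≤ r}) : ∃ z, f z = ⨅ z, f z := by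
  rcases eq_or_ne (⨅ z, f z) ⊤ with h | h
  · exact ⟨Classical.arbitrary A, h ▸ iInf_eq_top.1 h _⟩
  · obtain ⟨u, hu, hlt, hlim⟩ := exists_seq_strictAnti_tendsto' (lt_top_iff_ne_top.2 h)
    obtain ⟨z, hz⟩ := exists_forall_le_of_isCompact (g := fun _ => f) (r := u) monotone_const
      hu.antitone (fun k => hc _ (hlt k).2.ne)
      (fun k => (iInf_lt_iff.1 (hlt k).1).imp fun _ => le_of_lt)
    exact ⟨z, le_antisymm (ge_of_tendsto' hlim hz) (iInf_le _ z)⟩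

/-- If an increasing sequence of functions with compact sublevel sets has infima bounded by `L`,
then its pointwise supremum is bounded by `L` at some point. -/
theorem exists_forall_le_of_iInf_le {A : Type*} [TopologicalSpace A] [T2Space A] [Nonempty A]
    {g : ℕ → A → ℝ≥0∞} {L : ℝ≥0∞} (hg : Monotone g)
    (hc : ∀ k, ∀ r, r ≠ ⊤ → IsCompact {z | g k z ≤ r}) (hL : ∀ k, ⨅ z, g k z ≤ L) :
    ∃ z, ∀ k, g k z ≤ L := by
  rcases eq_or_ne L ⊤ with rfl | h
  · exact ⟨Classical.arbitrary A, fun _ => le_top⟩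
  · refine exists_forall_le_of_isCompact hg (r := fun _ => L) antitone_const (fun k => hc k L h)
      fun k => ?_
    obtain ⟨z, hz⟩ := exists_eq_iInf_of_isCompact (hc k)
    exact ⟨z, hz ▸ hL k⟩

/-- Distances to the points of a dense sequence. -/
def edistSeq (A : Type*) [MetricSpace A] [TopologicalSpace.SeparableSpace A] [Nonempty A]
    (a : A) (n : ℕ) : ℝ≥0∞ :=
  edist a (TopologicalSpace.denseSeq A n)

section

variable {A : Type*} [MetricSpace A] [TopologicalSpace.SeparableSpace A] [Nonempty A]

theorem continuous_edistSeq : Continuous (edistSeq A) :=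
  continuous_pi fun _ => continuous_id.edist continuous_const

theorem edistSeq_injective : Function.Injective (edistSeq A) := by
  intro a b h
  have hcl : IsClosed {d : A | edist a d = edist b d} :=
    isClosed_eq (continuous_const.edist continuous_id) (continuous_const.edist continuous_id)
  have : (univ : Set A) ⊆ {d : A | edist a d = edist b d} := by
    rw [← (TopologicalSpace.denseRange_denseSeq A).closure_range]
    refine hcl.closure_subset_iff.2 ?_
    rintro _ ⟨n, rfl⟩
    exact congrFun h n
  have h' : edist a a = edist b a := this (mem_univ a)
  rw [edist_self] at h'
  exact (edist_eq_zero.1 h'.symm).symm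

variable [MeasurableSpace A] [BorelSpace A] [StandardBorelSpace A]

theorem measurableEmbedding_edistSeq : MeasurableEmbedding (edistSeq A) :=
  continuous_edistSeq.measurable.measurableEmbedding edistSeq_injective

variable {X : Type*} [MeasurableSpace X] [StandardBorelSpace X]

/-- The projection of a Borel set with compact sections is Borel. -/
theorem measurableSet_image_fst_of_isCompact {B : Set (X × A)} (hB : MeasurableSet B)
    (hc : ∀ x, IsCompact {z | (x, z) ∈ B}) : MeasurableSet (Prod.fst '' B) := by
  have he : MeasurableEmbedding (Prod.map (id : X → X) (edistSeq A)) :=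
    MeasurableEmbedding.id.prodMap measurableEmbedding_edistSeq
  have := measurableSet_image_fst_of_isClosed (he.measurableSet_image.2 hB) fun x => by
    have : {z | (x, z) ∈ Prod.map (id : X → X) (edistSeq A) '' B}
        = edistSeq A '' {z | (x, z) ∈ B} := by
      ext z
      simp
    rw [this]
    exact ((hc x).image continuous_edistSeq).isClosed
  rwa [image_image] at this

theorem measurable_iInf_of_isCompact {f : X → A → ℝ≥0∞} (hf : Measurable fun p : X × A => f p.1 p.2)
    (hc : ∀ x, ∀ r, r ≠ ⊤ → IsCompact {z | f x z ≤ r}) : Measurable fun x => ⨅ z, f x z := by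
  refine measurable_of_Iic fun r => ?_
  rcases eq_or_ne r ⊤ with rfl | hr
  · simp
  have : (fun x => ⨅ z, f x z) ⁻¹' Iic r = Prod.fst '' {p : X × A | f p.1 p.2 ≤ r} := by
    ext x
    simp only [mem_preimage, mem_Iic, mem_image, mem_ofPred_eq, Prod.exists, exists_and_right,
      exists_eq_right]
    constructor
    · intro h
      obtain ⟨z, hz⟩ := exists_eq_iInf_of_isCompact (hc x)
      exact ⟨z, hz ▸ h⟩
    · rintro ⟨z, hz⟩
      exact (iInf_le _ z).trans hz
  rw [this]
  exact measurableSet_image_fst_of_isCompact (measurableSet_le hf measurable_const)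
    fun x => hc x r hr


/-- Restricting a Borel set with nonempty compact sections to the points of each section that
minimize a continuous function. -/
theorem exists_subset_argmin {G : Set (X × A)} (hG : MeasurableSet G)
    (hc : ∀ x, IsCompact {z | (x, z) ∈ G}) (hne : ∀ x, ∃ z, (x, z) ∈ G) {g : A → ℝ≥0∞}
    (hg : Continuous g) :
    ∃ G' ⊆ G, MeasurableSet G' ∧ (∀ x, IsCompact {z | (x, z) ∈ G'}) ∧ (∀ x, ∃ z, (x, z) ∈ G') ∧
      ∃ m : X → ℝ≥0∞, Measurable m ∧ ∀ p ∈ G', g p.2 = m p.1 := by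
  classical
  let F : X → A → ℝ≥0∞ := fun x z => if (x, z) ∈ G then g z else ⊤
  have hFm : Measurable fun p : X × A => F p.1 p.2 :=
    Measurable.ite hG (hg.measurable.comp measurable_snd) measurable_const
  have hFc : ∀ x r, r ≠ ⊤ → IsCompact {z | F x z ≤ r} := by
    intro x r hr
    have : {z | F x z ≤ r} = {z | (x, z) ∈ G} ∩ {z | g z ≤ r} := by
      ext z
      by_cases hz : (x, z) ∈ G <;> simp [F, hz, hr]
    rw [this]
    exact (hc x).inter_right (isClosed_le hg continuous_const)
  have hm := measurable_iInf_of_isCompact hFm hFc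
  refine ⟨G ∩ {p | g p.2 = ⨅ z, F p.1 z}, inter_subset_left,
    hG.inter (measurableSet_eq_fun (hg.measurable.comp measurable_snd) (hm.comp measurable_fst)),
    fun x => ?_, fun x => ?_, _, hm, fun p hp => hp.2⟩
  · exact (hc x).inter_right (isClosed_eq (f := g) (g := fun _ => ⨅ z, F x z) hg continuous_const)
  · obtain ⟨z₀, hz₀⟩ := hne x
    obtain ⟨z, hz, hmin⟩ := (hc x).exists_isMinOn ⟨z₀, hz₀⟩ hg.continuousOn
    refine ⟨z, hz, le_antisymm (le_iInf fun y => ?_) ?_⟩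
    · by_cases hy : (x, y) ∈ G
      · simpa [F, hy] using hmin hy
      · simp [F, hy]
    · refine (iInf_le _ z).trans ?_
      simp only [F]
      rw [if_pos (show (x, z) ∈ G from hz)]

/-- A Borel set with nonempty compact sections has a Borel uniformization. -/
theorem exists_measurable_selector {G : Set (X × A)} (hG : MeasurableSet G)
    (hc : ∀ x, IsCompact {z | (x, z) ∈ G}) (hne : ∀ x, ∃ z, (x, z) ∈ G) :
    ∃ φ : X → A, Measurable φ ∧ ∀ x, (x, φ x) ∈ G := by
  let T := {G : Set (X × A) // MeasurableSet G ∧ (∀ x, IsCompact {z | (x, z) ∈ G}) ∧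
    ∀ x, ∃ z, (x, z) ∈ G}
  have step : ∀ (k : ℕ) (G : T), ∃ G' : T, G'.1 ⊆ G.1 ∧
      ∃ m : X → ℝ≥0∞, Measurable m ∧ ∀ p ∈ G'.1, edistSeq A p.2 k = m p.1 := by
    rintro k ⟨G, h1, h2, h3⟩
    obtain ⟨G', hs, h1', h2', h3', m, hm⟩ := exists_subset_argmin h1 h2 h3
      ((continuous_apply k).comp (continuous_edistSeq (A := A)))
    exact ⟨⟨G', h1', h2', h3'⟩, hs, m, hm⟩
  choose next hsub m hm hmeq using step
  let S : ℕ → T := fun k => Nat.rec ⟨G, hG, hc, hne⟩ next k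
  have hS : ∀ k, S (k + 1) = next k (S k) := fun k => rfl
  have hex : ∀ x, ∃ z, ∀ k, (x, z) ∈ (S k).1 := by
    intro x
    obtain ⟨z, hz⟩ := IsCompact.nonempty_iInter_of_sequence_nonempty_isCompact_isClosed
      (fun k => {z | (x, z) ∈ (S k).1}) (fun k z hz => hsub k (S k) hz)
      (fun k => (S k).2.2.2 x) ((S 0).2.2.1 x) fun k => ((S k).2.2.1 x).isClosed
    exact ⟨z, fun k => mem_iInter.1 hz k⟩
  choose φ hφ using hex
  refine ⟨φ, ?_, fun x => hφ x 0⟩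
  rw [← (measurableEmbedding_edistSeq (A := A)).measurable_comp_iff]
  refine measurable_pi_iff.2 fun k => ?_
  have : (fun x => (edistSeq A ∘ φ) x k) = m k (S k) :=
    funext fun x => hmeq k (S k) (x, φ x) (hφ x (k + 1))
  rw [this]
  exact hm k (S k)

/-- **Measurable selection of minimizers** of a function with compact sublevel sets. -/
theorem exists_measurable_argmin {f : X → A → ℝ≥0∞} (hf : Measurable fun p : X × A => f p.1 p.2)
    (hc : ∀ x, ∀ r, r ≠ ⊤ → IsCompact {z | f x z ≤ r}) :
    ∃ φ : X → A, Measurable φ ∧ ∀ x, f x (φ x) = ⨅ z, f x z := by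
  have hv := measurable_iInf_of_isCompact hf hc
  have z₀ : A := Classical.arbitrary A
  have htop : MeasurableSet {x | ⨅ z, f x z = ⊤} := hv (measurableSet_singleton ⊤)
  have hmem : ∀ x, {z | f x z ≤ ⨅ z, f x z ∧ ¬ (⨅ z, f x z = ⊤ ∧ z ≠ z₀)}
      = if ⨅ z, f x z = ⊤ then {z₀} else {z | f x z ≤ ⨅ z, f x z} := by
    intro x
    split_ifs with h <;> ext z <;> simp [h]
  obtain ⟨φ, hφ, hG⟩ := exists_measurable_selector
    (G := {p : X × A | f p.1 p.2 ≤ ⨅ z, f p.1 z ∧ ¬ (⨅ z, f p.1 z = ⊤ ∧ p.2 ≠ z₀)})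
    ((measurableSet_le hf (hv.comp measurable_fst)).inter
      ((measurable_fst htop).inter (measurable_snd (measurableSet_singleton z₀)).compl).compl)
    (fun x => by
      simp only [mem_ofPred_eq]
      rw [hmem x]
      split_ifs with h
      · exact isCompact_singleton
      · exact hc x _ h)
    (fun x => by
      rcases eq_or_ne (⨅ z, f x z) ⊤ with h | h
      · exact ⟨z₀, h ▸ le_top, by simp⟩
      · obtain ⟨z, hz⟩ := exists_eq_iInf_of_isCompact (hc x)
        exact ⟨z, hz.le, fun h' => h h'.1⟩)
  exact ⟨φ, hφ, fun x => le_antisymm (hG x).1 (iInf_le _ _)⟩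

end

section Marginals

variable {X A : Type*} [MeasurableSpace X] [MeasurableSpace A]

attribute [instance] MDP.markov Policy.markov

theorem measurable_finSnoc {α β : Type*} [MeasurableSpace α] [MeasurableSpace β] {t : ℕ}
    {f : β → Fin t → α} {g : β → α} (hf : Measurable f) (hg : Measurable g) :
    Measurable fun b => (Fin.snoc (f b) (g b) : Fin (t + 1) → α) := by
  refine measurable_pi_iff.2 fun i => ?_
  induction i using Fin.lastCases with
  | last => simpa using hg
  | cast i => simpa [Function.comp_def] using (measurable_pi_apply i).comp hf

theorem measurable_histNext (t : ℕ) :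
    Measurable fun p : (Hist X A t × A) × X =>
      ((Fin.snoc p.1.1.1 (p.1.1.2, p.1.2), p.2) : Hist X A (t + 1)) := by
  refine Measurable.prodMk (measurable_finSnoc ?_ ?_) ?_ <;> fun_prop

variable (M : MDP X A) (p : Policy X A) (x : X)

theorem measurable_map_histNext (t : ℕ) :
    Measurable fun z : Hist X A t × A => (M.q (z.1.2, z.2)).map fun x' =>
      ((Fin.snoc z.1.1 (z.1.2, z.2), x') : Hist X A (t + 1)) := by
  let κ : Kernel (Hist X A t × A) X :=
    M.q.comap (fun z => (z.1.2, z.2)) (by fun_prop)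
  refine Measure.measurable_of_measurable_coe _ fun s hs => ?_
  have h := Kernel.measurable_kernel_prodMk_left (κ := κ) (measurable_histNext t hs)
  have heq : ∀ z : Hist X A t × A, (M.q (z.1.2, z.2)).map
      (fun x' => ((Fin.snoc z.1.1 (z.1.2, z.2), x') : Hist X A (t + 1))) s
      = κ z (Prod.mk z ⁻¹' ((fun p : (Hist X A t × A) × X =>
        ((Fin.snoc p.1.1.1 (p.1.1.2, p.1.2), p.2) : Hist X A (t + 1))) ⁻¹' s)) :=
    fun z => Measure.map_apply ((measurable_histNext t).comp measurable_prodMk_left) hs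
  simp_rw [heq]
  exact h

theorem measurable_histStep (t : ℕ) :
    Measurable fun h : Hist X A t => ((p.π t) h).bind fun a =>
      (M.q (h.2, a)).map fun x' => ((Fin.snoc h.1 (h.2, a), x') : Hist X A (t + 1)) := by
  refine Measure.measurable_of_measurable_coe _ fun s hs => ?_
  have h1 := measurable_map_histNext M t
  have h2 : ∀ h : Hist X A t, (((p.π t) h).bind fun a =>
      (M.q (h.2, a)).map fun x' => ((Fin.snoc h.1 (h.2, a), x') : Hist X A (t + 1))) s
      = ∫⁻ a, (M.q (h.2, a)).map (fun x' => (Fin.snoc h.1 (h.2, a), x')) s ∂(p.π t) h :=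
    fun h => Measure.bind_apply hs (h1.comp measurable_prodMk_left).aemeasurable
  simp_rw [h2]
  exact Measurable.lintegral_kernel_prod_right' ((Measure.measurable_coe hs).comp h1)

theorem measurable_saStep (t : ℕ) :
    Measurable fun h : Hist X A t => ((p.π t) h).map fun a => (h.2, a) := by
  refine Measure.measurable_of_measurable_coe _ fun s hs => ?_
  have h2 : ∀ h : Hist X A t, ((p.π t) h).map (fun a => (h.2, a)) s
      = (p.π t) h (Prod.mk h ⁻¹' ((fun z : Hist X A t × A => (z.1.2, z.2)) ⁻¹' s)) :=
    fun h => Measure.map_apply measurable_prodMk_left hs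
  simp_rw [h2]
  exact Kernel.measurable_kernel_prodMk_left
    (hs.preimage (by fun_prop : Measurable fun z : Hist X A t × A => (z.1.2, z.2)))

theorem lintegral_saMeas (t : ℕ) {g : X × A → ℝ≥0∞} (hg : Measurable g) :
    ∫⁻ z, g z ∂saMeas M p x t = ∫⁻ h, ∫⁻ b, g (h.2, b) ∂(p.π t) h ∂histMeas M p x t := by
  rw [saMeas, Measure.lintegral_bind (measurable_saStep p t).aemeasurable hg.aemeasurable]
  exact lintegral_congr fun h => lintegral_map hg measurable_prodMk_left

theorem lintegral_fst_saMeas (t : ℕ) {f : X → ℝ≥0∞} (hf : Measurable f) :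
    ∫⁻ z, f z.1 ∂saMeas M p x t = ∫⁻ h, f h.2 ∂histMeas M p x t := by
  rw [lintegral_saMeas M p x t (g := fun z => f z.1) (hf.comp measurable_fst)]
  simp

theorem lintegral_snd_histMeas_succ (t : ℕ) {f : X → ℝ≥0∞} (hf : Measurable f) :
    ∫⁻ h, f h.2 ∂histMeas M p x (t + 1) = ∫⁻ z, ∫⁻ y, f y ∂M.q z ∂saMeas M p x t := by
  have hf' : ∀ s, Measurable fun h : Hist X A s => f h.2 := fun s => hf.comp measurable_snd
  rw [lintegral_saMeas M p x t hf.lintegral_kernel, histMeas,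
    Measure.lintegral_bind (measurable_histStep M p t).aemeasurable (hf' _).aemeasurable]
  refine lintegral_congr fun h => ?_
  have hm : Measurable fun b => (M.q (h.2, b)).map fun x' =>
      ((Fin.snoc h.1 (h.2, b), x') : Hist X A (t + 1)) :=
    (measurable_map_histNext M t).comp (measurable_prodMk_left (x := h))
  rw [Measure.lintegral_bind hm.aemeasurable (hf' _).aemeasurable]
  refine lintegral_congr fun b => ?_
  exact lintegral_map (hf' _)
    ((measurable_histNext t).comp (measurable_prodMk_left (x := (h, b))))

theorem lintegral_snd_histMeas_zero {f : X → ℝ≥0∞} (hf : Measurable f) :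
    ∫⁻ h, f h.2 ∂histMeas M p x 0 = f x := by
  have hf' : Measurable fun h : Hist X A 0 => f h.2 := hf.comp measurable_snd
  rw [histMeas, lintegral_dirac' _ hf']

instance isProbabilityMeasure_histMeas (t : ℕ) : IsProbabilityMeasure (histMeas M p x t) := by
  induction t with
  | zero => rw [histMeas]; infer_instance
  | succ t ih =>
    have h1 : ∫⁻ h, (fun _ => 1) h.2 ∂histMeas M p x (t + 1) = 1 := by
      rw [lintegral_snd_histMeas_succ M p x t measurable_const,
        lintegral_saMeas M p x t (measurable_const.lintegral_kernel)]
      simp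
    exact ⟨by simpa using h1⟩

instance isProbabilityMeasure_saMeas (t : ℕ) : IsProbabilityMeasure (saMeas M p x t) := by
  have h1 := lintegral_fst_saMeas M p x t (f := fun _ => 1) measurable_const
  exact ⟨by simpa using h1⟩

theorem lintegral_saMeas_detPolicy {φ : X → A} (hφ : Measurable φ) (t : ℕ) {g : X × A → ℝ≥0∞}
    (hg : Measurable g) :
    ∫⁻ z, g z ∂saMeas M (detPolicy φ hφ) x t
      = ∫⁻ h, g (h.2, φ h.2) ∂histMeas M (detPolicy φ hφ) x t := by
  rw [lintegral_saMeas M _ x t hg]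
  refine lintegral_congr fun h => ?_
  exact Kernel.lintegral_deterministic' (hφ.comp measurable_snd)
    (hg.comp (measurable_prodMk_left (x := h.2)))

end Marginals

section Bellman

variable {X A : Type*} [MeasurableSpace X] [MeasurableSpace A]

/-- The one-step cost `C` plus the expected terminal reward `w` after one transition. -/
def bellman (M : MDP X A) (C : X → A → ℝ≥0∞) (w : X → ℝ≥0∞) (x : X) (b : A) : ℝ≥0∞ :=
  C x b + ∫⁻ y, w y ∂M.q (x, b)

/-- The expected cost at time `t` for the nonnegative cost function `C`. -/
def stepCost (M : MDP X A) (C : X → A → ℝ≥0∞) (p : Policy X A) (x : X) (t : ℕ) : ℝ≥0∞ :=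
  ∫⁻ z, C z.1 z.2 ∂saMeas M p x t

/-- The optimal discounted cost for the nonnegative cost function `C`. -/
def discOpt (M : MDP X A) (C : X → A → ℝ≥0∞) (β : ℝ≥0∞) (x : X) : ℝ≥0∞ :=
  ⨅ p : Policy X A, ∑' t, β ^ t * stepCost M C p x t

/-- Value iteration started from zero. -/
def valueIter (M : MDP X A) (C : X → A → ℝ≥0∞) (β : ℝ≥0∞) : ℕ → X → ℝ≥0∞
  | 0 => 0
  | n + 1 => fun x => ⨅ b, bellman M C (fun y => β * valueIter M C β n y) x b

variable {M : MDP X A} {C : X → A → ℝ≥0∞} {β : ℝ≥0∞}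

theorem bellman_mono {w w' : X → ℝ≥0∞} (h : ∀ y, w y ≤ w' y) (x : X) (b : A) :
    bellman M C w x b ≤ bellman M C w' x b :=
  add_le_add_right (lintegral_mono h) _

theorem measurable_bellman (hC : Measurable fun p : X × A => C p.1 p.2) {w : X → ℝ≥0∞}
    (hw : Measurable w) : Measurable fun p : X × A => bellman M C w p.1 p.2 :=
  hC.add hw.lintegral_kernel

theorem lintegral_bellman_saMeas (hC : Measurable fun p : X × A => C p.1 p.2) {w : X → ℝ≥0∞}
    (hw : Measurable w) (p : Policy X A) (x : X) (t : ℕ) :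
    ∫⁻ z, bellman M C w z.1 z.2 ∂saMeas M p x t
      = stepCost M C p x t + ∫⁻ h, w h.2 ∂histMeas M p x (t + 1) := by
  rw [lintegral_snd_histMeas_succ M p x t hw, stepCost, ← lintegral_add_left hC]
  rfl

theorem lintegral_valueIter_le (hC : Measurable fun p : X × A => C p.1 p.2)
    (hm : ∀ n, Measurable (valueIter M C β n)) (p : Policy X A) (x : X) (n t : ℕ) :
    ∫⁻ h, valueIter M C β n h.2 ∂histMeas M p x t
      ≤ ∑ s ∈ Finset.range n, β ^ s * stepCost M C p x (t + s) := by
  induction n generalizing t with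
  | zero => simp [valueIter]
  | succ n ih =>
    have hmul : ∀ n, Measurable fun y => β * valueIter M C β n y := fun n => (hm n).const_mul β
    calc ∫⁻ h, valueIter M C β (n + 1) h.2 ∂histMeas M p x t
        = ∫⁻ z, valueIter M C β (n + 1) z.1 ∂saMeas M p x t :=
          (lintegral_fst_saMeas M p x t (hm _)).symm
      _ ≤ ∫⁻ z, bellman M C (fun y => β * valueIter M C β n y) z.1 z.2 ∂saMeas M p x t :=
          lintegral_mono fun z => iInf_le _ z.2
      _ = stepCost M C p x t + β * ∫⁻ h, valueIter M C β n h.2 ∂histMeas M p x (t + 1) := by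
          rw [lintegral_bellman_saMeas hC (hmul n),
            lintegral_const_mul β (f := fun h : Hist X A (t + 1) => valueIter M C β n h.2)
              ((hm n).comp measurable_snd)]
      _ ≤ stepCost M C p x t
            + β * ∑ s ∈ Finset.range n, β ^ s * stepCost M C p x (t + 1 + s) := by
          gcongr
          exact ih _
      _ = _ := by
          rw [Finset.sum_range_succ', Finset.mul_sum, add_comm]
          simp only [pow_zero, one_mul, add_zero]
          congr 1
          refine Finset.sum_congr rfl fun s _ => ?_
          rw [pow_succ', mul_assoc, add_assoc, add_comm 1 s]

theorem valueIter_le_discOpt (hC : Measurable fun p : X × A => C p.1 p.2)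
    (hm : ∀ n, Measurable (valueIter M C β n)) (n : ℕ) (x : X) :
    valueIter M C β n x ≤ discOpt M C β x := by
  refine le_iInf fun p => ?_
  have := lintegral_valueIter_le hC hm p x n 0
  rw [lintegral_snd_histMeas_zero M p x (hm n)] at this
  refine this.trans ?_
  simp only [zero_add]
  exact ENNReal.sum_le_tsum _

theorem stepCost_detPolicy_add (hC : Measurable fun p : X × A => C p.1 p.2) {w v : X → ℝ≥0∞}
    (hw : Measurable w) {φ : X → A} (hφ : Measurable φ)
    (h : ∀ x, bellman M C w x (φ x) ≤ v x) (x : X) (t : ℕ) :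
    stepCost M C (detPolicy φ hφ) x t + ∫⁻ h, w h.2 ∂histMeas M (detPolicy φ hφ) x (t + 1)
      ≤ ∫⁻ h, v h.2 ∂histMeas M (detPolicy φ hφ) x t := by
  rw [← lintegral_bellman_saMeas hC hw,
    lintegral_saMeas_detPolicy M x hφ t (measurable_bellman hC hw)]
  exact lintegral_mono fun z => h z.2

theorem sum_stepCost_detPolicy_le (hC : Measurable fun p : X × A => C p.1 p.2) {w : X → ℝ≥0∞}
    (hw : Measurable w) {φ : X → A} (hφ : Measurable φ)
    (h : ∀ x, bellman M C (fun y => β * w y) x (φ x) ≤ w x) (x : X) (n t : ℕ) :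
    ∑ s ∈ Finset.range n, β ^ s * stepCost M C (detPolicy φ hφ) x (t + s)
      ≤ ∫⁻ h, w h.2 ∂histMeas M (detPolicy φ hφ) x t := by
  induction n generalizing t with
  | zero => simp
  | succ n ih =>
    refine le_trans ?_ (stepCost_detPolicy_add hC (hw.const_mul β) hφ h x t)
    rw [lintegral_const_mul β (f := fun h : Hist X A (t + 1) => w h.2) (hw.comp measurable_snd),
      Finset.sum_range_succ', add_comm]
    simp only [pow_zero, one_mul, add_zero]
    gcongr
    refine le_trans (le_of_eq ?_) (mul_le_mul_right (ih (t + 1)) β)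
    rw [Finset.mul_sum]
    refine Finset.sum_congr rfl fun s _ => ?_
    rw [pow_succ', mul_assoc, add_assoc, add_comm 1 s]

theorem discOpt_le_of_bellman_le (hC : Measurable fun p : X × A => C p.1 p.2) {w : X → ℝ≥0∞}
    (hw : Measurable w) {φ : X → A} (hφ : Measurable φ)
    (h : ∀ x, bellman M C (fun y => β * w y) x (φ x) ≤ w x) (x : X) :
    discOpt M C β x ≤ w x := by
  refine (iInf_le _ (detPolicy φ hφ)).trans (ENNReal.tsum_le_of_sum_range_le fun n => ?_)
  have := sum_stepCost_detPolicy_le hC hw hφ h x n 0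
  rw [lintegral_snd_histMeas_zero _ _ _ hw] at this
  simpa using this

/-- A stationary policy whose Bellman inequality holds up to an additive constant `g` has
total cost over `N` steps at most `N * g` plus the initial value. -/
theorem sum_stepCost_detPolicy_le_add (hC : Measurable fun p : X × A => C p.1 p.2)
    {w : X → ℝ≥0∞} (hw : Measurable w) {φ : X → A} (hφ : Measurable φ) {g : ℝ≥0∞}
    (h : ∀ x, bellman M C w x (φ x) ≤ g + w x) (x : X) (N : ℕ) :
    ∑ s ∈ Finset.range N, stepCost M C (detPolicy φ hφ) x s
      + ∫⁻ h, w h.2 ∂histMeas M (detPolicy φ hφ) x N ≤ N * g + w x := by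
  induction N with
  | zero => simp [lintegral_snd_histMeas_zero _ _ _ hw]
  | succ N ih =>
    have hstep := stepCost_detPolicy_add hC hw hφ h x N
    rw [lintegral_add_left measurable_const, lintegral_const, measure_univ, mul_one] at hstep
    calc _ = ∑ s ∈ Finset.range N, stepCost M C (detPolicy φ hφ) x s
          + (stepCost M C (detPolicy φ hφ) x N
            + ∫⁻ h, w h.2 ∂histMeas M (detPolicy φ hφ) x (N + 1)) := by
          rw [Finset.sum_range_succ, add_assoc]
      _ ≤ ∑ s ∈ Finset.range N, stepCost M C (detPolicy φ hφ) x s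
          + (g + ∫⁻ h, w h.2 ∂histMeas M (detPolicy φ hφ) x N) := by gcongr
      _ = g + (∑ s ∈ Finset.range N, stepCost M C (detPolicy φ hφ) x s
          + ∫⁻ h, w h.2 ∂histMeas M (detPolicy φ hφ) x N) := by ring
      _ ≤ g + (N * g + w x) := by gcongr
      _ = _ := by push_cast; ring

theorem monotone_valueIter : Monotone (valueIter M C β) := by
  refine monotone_nat_of_le_succ fun n => ?_
  induction n with
  | zero => exact fun x => zero_le
  | succ n ih =>
    exact fun x => iInf_mono fun b => bellman_mono (fun y => mul_le_mul_right (ih y) β) x b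

end Bellman

/-- Setwise continuity of the transition probability makes expectations of nonnegative functions
lower semicontinuous in the action. -/
theorem lowerSemicontinuous_lintegral_of_setwise {X A : Type*} [MeasurableSpace X]
    [MeasurableSpace A] [TopologicalSpace A] {M : MDP X A}
    (hq : ∀ x, ∀ B : Set X, MeasurableSet B → Continuous fun b : A => M.q (x, b) B)
    {w : X → ℝ≥0∞} (hw : Measurable w) (x : X) :
    LowerSemicontinuous fun b : A => ∫⁻ y, w y ∂M.q (x, b) := by
  have : (fun b : A => ∫⁻ y, w y ∂M.q (x, b))
      = fun b => ⨆ n, (SimpleFunc.eapprox w n).lintegral (M.q (x, b)) :=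
    funext fun b => lintegral_eq_iSup_eapprox_lintegral hw
  rw [this]
  refine lowerSemicontinuous_iSup fun n => Continuous.lowerSemicontinuous ?_
  simp only [SimpleFunc.lintegral]
  refine continuous_finsetSum _ fun r hr => ?_
  refine (ENNReal.continuous_const_mul ?_).comp (hq x _ (SimpleFunc.measurableSet_fiber _ _))
  obtain ⟨y, rfl⟩ := SimpleFunc.mem_range.1 hr
  exact (SimpleFunc.eapprox_lt_top w n y).ne

/-- The Bellman operand inherits compact sublevel sets from the one-step cost. -/
theorem isCompact_bellman_le {X A : Type*} [MeasurableSpace X]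
    [MeasurableSpace A] [TopologicalSpace A] [T2Space A] {M : MDP X A} {C : X → A → ℝ≥0∞}
    (hCc : ∀ x r, r ≠ ⊤ → IsCompact {b | C x b ≤ r})
    (hq : ∀ x, ∀ B : Set X, MeasurableSet B → Continuous fun b : A => M.q (x, b) B)
    {w : X → ℝ≥0∞} (hw : Measurable w) (x : X) (r : ℝ≥0∞) (hr : r ≠ ⊤) :
    IsCompact {b | bellman M C w x b ≤ r} := by
  have hlsc : LowerSemicontinuous (C x) := by
    refine lowerSemicontinuous_iff_isClosed_preimage.2 fun y => ?_
    rcases eq_or_ne y ⊤ with rfl | hy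
    · simp
    · exact (hCc x y hy).isClosed
  have hcl : IsClosed {b | bellman M C w x b ≤ r} :=
    lowerSemicontinuous_iff_isClosed_preimage.1
      (hlsc.add (lowerSemicontinuous_lintegral_of_setwise hq hw x)) r
  exact (hCc x r hr).of_isClosed_subset hcl fun b (hb : bellman M C w x b ≤ r) =>
    show C x b ≤ r from le_self_add.trans hb

section InfCompact

variable {X A : Type*} [MeasurableSpace X] [MetricSpace A] [MeasurableSpace A]
  {M : MDP X A} {C : X → A → ℝ≥0∞} {β : ℝ≥0∞}

theorem exists_bellman_iSup_le [Nonempty A] (hCc : ∀ x r, r ≠ ⊤ → IsCompact {b | C x b ≤ r})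
    (hq : ∀ x, ∀ B : Set X, MeasurableSet B → Continuous fun b : A => M.q (x, b) B)
    {W : ℕ → X → ℝ≥0∞} (hW : ∀ k, Measurable (W k)) (hmono : Monotone W) {x : X} {L : ℝ≥0∞}
    (hL : ∀ k, ⨅ b, bellman M C (W k) x b ≤ L) :
    ∃ b, bellman M C (fun y => ⨆ k, W k y) x b ≤ L := by
  obtain ⟨b, hb⟩ := exists_forall_le_of_iInf_le (g := fun k => bellman M C (W k) x)
    (fun i j hij b => bellman_mono (fun y => hmono hij y) x b)
    (fun k => isCompact_bellman_le hCc hq (hW k) x) hL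
  refine ⟨b, ?_⟩
  rw [bellman, lintegral_iSup hW hmono, ENNReal.add_iSup]
  exact iSup_le hb

variable [StandardBorelSpace X] [TopologicalSpace.SeparableSpace A] [BorelSpace A]
  [StandardBorelSpace A] [Nonempty A]

theorem measurable_valueIter (hC : Measurable fun p : X × A => C p.1 p.2)
    (hCc : ∀ x r, r ≠ ⊤ → IsCompact {b | C x b ≤ r})
    (hq : ∀ x, ∀ B : Set X, MeasurableSet B → Continuous fun b : A => M.q (x, b) B) (n : ℕ) :
    Measurable (valueIter M C β n) := by
  induction n with
  | zero => exact measurable_const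
  | succ n ih =>
    exact measurable_iInf_of_isCompact (measurable_bellman hC (ih.const_mul β))
      (isCompact_bellman_le hCc hq (ih.const_mul β))

/-- The optimal discounted cost is measurable and satisfies the optimality equation. -/
theorem measurable_discOpt_and_eq_iInf_bellman (hC : Measurable fun p : X × A => C p.1 p.2)
    (hCc : ∀ x r, r ≠ ⊤ → IsCompact {b | C x b ≤ r})
    (hq : ∀ x, ∀ B : Set X, MeasurableSet B → Continuous fun b : A => M.q (x, b) B) :
    Measurable (discOpt M C β) ∧
      ∀ x, discOpt M C β x = ⨅ b, bellman M C (fun y => β * discOpt M C β y) x b := by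
  have hm := measurable_valueIter (β := β) hC hCc hq
  have hmul : ∀ n, Measurable fun y => β * valueIter M C β n y := fun n => (hm n).const_mul β
  let w : X → ℝ≥0∞ := fun x => ⨆ n, valueIter M C β n x
  have hw : Measurable w := .iSup hm
  have hle : ∀ x, ⨅ b, bellman M C (fun y => β * w y) x b ≤ w x := by
    intro x
    obtain ⟨b, hb⟩ := exists_bellman_iSup_le (W := fun k y => β * valueIter M C β k y) (x := x)
      (L := w x) hCc hq hmul
      (fun i j hij y => mul_le_mul_right (monotone_valueIter hij y) β)
      (fun k => le_iSup (fun n => valueIter M C β n x) (k + 1))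
    simp_rw [← ENNReal.mul_iSup] at hb
    exact (iInf_le _ b).trans hb
  have hge : ∀ x, w x ≤ ⨅ b, bellman M C (fun y => β * w y) x b := by
    refine fun x => iSup_le fun n => ?_
    cases n with
    | zero => exact zero_le
    | succ n =>
      exact iInf_mono fun b => bellman_mono
        (fun y => mul_le_mul_right (le_iSup (fun n => valueIter M C β n y) n) β) x b
  obtain ⟨φ, hφ, hmin⟩ := exists_measurable_argmin (measurable_bellman (M := M) hC (hw.const_mul β))
    (isCompact_bellman_le hCc hq (hw.const_mul β))
  have heq : discOpt M C β = w := by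
    refine funext fun x => le_antisymm ?_ (iSup_le fun n => valueIter_le_discOpt hC hm n x)
    exact discOpt_le_of_bellman_le hC hw hφ (fun x => (hmin x).trans_le (hle x)) x
  rw [heq]
  exact ⟨hw, fun x => le_antisymm (hge x) (hle x)⟩

end InfCompact

section Abelian

/-- Partial sums growing at most linearly with slope `L` control discounted sums. -/
theorem sum_pow_mul_le {e : ℕ → ℝ≥0∞} {C₀ L β : ℝ≥0∞} (hC₀ : C₀ ≠ ⊤) (hL : L ≠ ⊤)
    (hβ : β ≤ 1) (h : ∀ N : ℕ, ∑ t ∈ Finset.range N, e t ≤ C₀ + N * L) (N : ℕ) :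
    ∑ t ∈ Finset.range N, β ^ t * e t ≤ C₀ + L * ∑ t ∈ Finset.range N, β ^ t := by
  choose d hd using fun N => le_iff_exists_add.1 (h N)
  have hfin : ∀ N : ℕ, ∑ t ∈ Finset.range N, e t ≠ ⊤ := fun N =>
    ne_top_of_le_ne_top (ENNReal.add_ne_top.2
      ⟨hC₀, ENNReal.mul_ne_top (ENNReal.natCast_ne_top N) hL⟩) (h N)
  have hstep : ∀ N, e N + d (N + 1) = d N + L := by
    intro N
    refine (ENNReal.add_right_inj (hfin N)).1 ?_
    rw [← add_assoc, ← Finset.sum_range_succ, ← hd, ← add_assoc, ← hd]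
    push_cast
    ring
  have key : ∀ N, ∑ t ∈ Finset.range N, β ^ t * e t + β ^ N * d N
      ≤ C₀ + L * ∑ t ∈ Finset.range N, β ^ t := by
    intro N
    induction N with
    | zero =>
      have := hd 0
      simp_all
    | succ N ih =>
      calc _ ≤ ∑ t ∈ Finset.range N, β ^ t * e t + β ^ N * (e N + d (N + 1)) := by
            rw [Finset.sum_range_succ, mul_add, add_assoc]
            gcongr _ + (_ + ?_ * _)
            exact pow_le_pow_right_of_le_one' hβ N.le_succ
        _ = (∑ t ∈ Finset.range N, β ^ t * e t + β ^ N * d N) + L * β ^ N := by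
            rw [hstep]
            ring
        _ ≤ (C₀ + L * ∑ t ∈ Finset.range N, β ^ t) + L * β ^ N := by gcongr
        _ = _ := by
            rw [Finset.sum_range_succ]
            ring
  exact le_self_add.trans (key N)

/-- Abelian inequality: normalized discounted sums are asymptotically bounded by Cesàro means. -/
theorem limsup_one_sub_mul_tsum_le {α : ℕ → ℝ≥0∞} (hα : Tendsto α atTop (𝓝 1))
    (hlt : ∀ n, α n < 1) (e : ℕ → ℝ≥0∞) :
    limsup (fun n => (1 - α n) * ∑' t, α n ^ t * e t) atTop
      ≤ limsup (fun N : ℕ => (N : ℝ≥0∞)⁻¹ * ∑ t ∈ Finset.range N, e t) atTop := by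
  refine le_of_forall_gt_imp_ge_of_dense fun L hL => ?_
  rcases eq_or_ne L ⊤ with rfl | hLt
  · exact le_top
  obtain ⟨N₀, hN₀⟩ := eventually_atTop.1 (eventually_lt_of_limsup_lt hL)
  have hbig : ∀ N : ℕ, N₀ + 1 ≤ N → ∑ t ∈ Finset.range N, e t ≤ N * L := by
    intro N hN
    have hN' : (N : ℝ≥0∞) ≠ 0 := by
      have : N ≠ 0 := by omega
      exact_mod_cast this
    have := mul_le_mul_right (hN₀ N (by omega)).le (N : ℝ≥0∞)
    rwa [← mul_assoc, ENNReal.mul_inv_cancel hN' (ENNReal.natCast_ne_top N), one_mul] at this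
  have hC₀ : ((N₀ + 1 : ℕ) : ℝ≥0∞) * L ≠ ⊤ := ENNReal.mul_ne_top (ENNReal.natCast_ne_top _) hLt
  have hall : ∀ N : ℕ, ∑ t ∈ Finset.range N, e t ≤ ((N₀ + 1 : ℕ) : ℝ≥0∞) * L + N * L := by
    intro N
    rcases le_total (N₀ + 1) N with hN | hN
    · exact (hbig N hN).trans le_add_self
    · exact (Finset.sum_le_sum_of_subset (Finset.range_mono hN)).trans
        ((hbig _ le_rfl).trans le_self_add)
  have hbound : ∀ n, (1 - α n) * ∑' t, α n ^ t * e t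
      ≤ (1 - α n) * (((N₀ + 1 : ℕ) : ℝ≥0∞) * L) + L := by
    intro n
    have h0 : 1 - α n ≠ 0 := (tsub_pos_of_lt (hlt n)).ne'
    have ht : 1 - α n ≠ ⊤ := ENNReal.sub_ne_top ENNReal.one_ne_top
    calc _ ≤ (1 - α n) * (((N₀ + 1 : ℕ) : ℝ≥0∞) * L + L * (1 - α n)⁻¹) := by
          gcongr
          refine ENNReal.tsum_le_of_sum_range_le fun N => ?_
          refine (sum_pow_mul_le hC₀ hLt (hlt n).le hall N).trans ?_
          gcongr
          exact (ENNReal.sum_le_tsum _).trans (ENNReal.tsum_geometric _).le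
      _ = _ := by
          rw [mul_add, mul_left_comm _ L, ENNReal.mul_inv_cancel h0 ht, mul_one]
  refine (limsup_le_limsup (Eventually.of_forall hbound)).trans (le_of_eq (Tendsto.limsup_eq ?_))
  have hsub : Tendsto (fun n => 1 - α n) atTop (𝓝 0) := by
    have := ENNReal.Tendsto.sub (tendsto_const_nhds (x := (1 : ℝ≥0∞))) hα (Or.inl ENNReal.one_ne_top)
    rwa [tsub_self] at this
  have := (ENNReal.Tendsto.mul_const (b := ((N₀ + 1 : ℕ) : ℝ≥0∞) * L) hsub (Or.inr hC₀)).add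
    (tendsto_const_nhds (x := L))
  simpa using this

end Abelian

section ENNRealLimits

theorem le_add_of_forall_gt {G c l : ℝ≥0∞} (h : ∀ r > l, G ≤ c + r) : G ≤ c + l :=
  tsub_le_iff_left.1 <| le_of_forall_gt_imp_ge_of_dense fun r hr => tsub_le_iff_left.2 (h r hr)

theorem le_add_limsup_of_tendsto {G c : ℝ≥0∞} {Gs cs ls : ℕ → ℝ≥0∞}
    (hG : Tendsto Gs atTop (𝓝 G)) (hc : Tendsto cs atTop (𝓝 c)) (h : ∀ n, Gs n ≤ cs n + ls n) :
    G ≤ c + limsup ls atTop := by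
  refine le_add_of_forall_gt fun r hr => ?_
  refine le_of_tendsto_of_tendsto hG (hc.add tendsto_const_nhds) ?_
  filter_upwards [eventually_lt_of_limsup_lt hr] with n hn
  exact (h n).trans (add_le_add_right hn.le _)

theorem le_add_liminf_of_tendsto {G c : ℝ≥0∞} {cs ls : ℕ → ℝ≥0∞}
    (hc : Tendsto cs atTop (𝓝 c)) (h : ∀ᶠ n in atTop, G ≤ cs n + ls n) :
    G ≤ c + liminf ls atTop := by
  refine le_add_of_forall_gt fun r hr => ?_
  refine ge_of_tendsto_of_frequently (hc.add (tendsto_const_nhds (x := r))) ?_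
  refine ((frequently_lt_of_liminf_lt (by isBoundedDefault) hr).and_eventually h).mono ?_
  rintro n ⟨hn, hn'⟩
  exact hn'.trans (add_le_add_right hn.le _)

/-- A reverse Fatou lemma for asymptotically uniformly integrable sequences, in a form that
passes a lower bound to the limit. -/
theorem le_add_lintegral_of_asymptotically_uniformIntegrable {X : Type*} [MeasurableSpace X]
    {μ : Measure X} [IsProbabilityMeasure μ] {u : ℕ → X → ℝ≥0∞} {U : X → ℝ≥0∞}
    (hu : ∀ n, Measurable (u n)) (hlim : ∀ x, Tendsto (fun n => u n x) atTop (𝓝 (U x)))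
    (hui : Tendsto (fun K : ℕ => limsup (fun n => ∫⁻ y in {y | (K : ℝ≥0∞) ≤ u n y}, u n y ∂μ) atTop)
      atTop (𝓝 0))
    {c G : ℝ≥0∞} {Gs : ℕ → ℝ≥0∞} (hG : Tendsto Gs atTop (𝓝 G))
    (h : ∀ n, Gs n ≤ c + ∫⁻ y, u n y ∂μ) : G ≤ c + ∫⁻ y, U y ∂μ := by
  have hK : ∀ K : ℕ, G ≤ c + ∫⁻ y, U y ∂μ
      + limsup (fun n => ∫⁻ y in {y | (K : ℝ≥0∞) ≤ u n y}, u n y ∂μ) atTop := by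
    intro K
    have hmin : Tendsto (fun n => ∫⁻ y, min (u n y) K ∂μ) atTop (𝓝 (∫⁻ y, min (U y) K ∂μ)) := by
      refine tendsto_lintegral_of_dominated_convergence (fun _ => (K : ℝ≥0∞))
        (fun n => (hu n).min measurable_const)
        (fun n => Eventually.of_forall fun y => min_le_right _ _) ?_
        (Eventually.of_forall fun y => (hlim y).min tendsto_const_nhds)
      simp
    have := le_add_limsup_of_tendsto (cs := fun n => c + ∫⁻ y, min (u n y) K ∂μ)
      (ls := fun n => ∫⁻ y in {y | (K : ℝ≥0∞) ≤ u n y}, u n y ∂μ) hG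
      (tendsto_const_nhds.add hmin) fun n => ?_
    · refine this.trans ?_
      gcongr
      exact min_le_left _ _
    · refine (h n).trans ?_
      rw [add_assoc]
      gcongr
      have hms : MeasurableSet {y | (K : ℝ≥0∞) ≤ u n y} := measurableSet_le measurable_const (hu n)
      rw [← lintegral_indicator hms, ← lintegral_add_left ((hu n).min measurable_const)]
      refine lintegral_mono fun y => ?_
      by_cases hy : (K : ℝ≥0∞) ≤ u n y
      · rw [indicator_of_mem (show y ∈ {y | (K : ℝ≥0∞) ≤ u n y} from hy)]
        exact le_add_self
      · exact (le_of_eq (min_eq_left (not_le.1 hy).le).symm).trans le_self_add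
  have := (tendsto_const_nhds (x := c + ∫⁻ y, U y ∂μ)).add hui
  rw [add_zero] at this
  exact ge_of_tendsto' this hK

end ENNRealLimits

section VanishingDiscount

variable {X A : Type*} [MeasurableSpace X] [MeasurableSpace A]

/-- The optimal average cost for the nonnegative cost function `C`. -/
def avgInf (M : MDP X A) (C : X → A → ℝ≥0∞) : ℝ≥0∞ :=
  ⨅ (x : X) (p : Policy X A),
    limsup (fun N : ℕ => (N : ℝ≥0∞)⁻¹ * ∑ t ∈ Finset.range N, stepCost M C p x t) atTop

/-- The discounted relative value function for the nonnegative cost function `C`. -/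
def relValue (M : MDP X A) (C : X → A → ℝ≥0∞) (β : ℝ≥0∞) (x : X) : ℝ≥0∞ :=
  discOpt M C β x - ⨅ y, discOpt M C β y

variable {M : MDP X A} {C : X → A → ℝ≥0∞}

theorem avgInf_le_of_bellman_le [Nonempty X] (hC : Measurable fun p : X × A => C p.1 p.2)
    {U : X → ℝ≥0∞} (hU : Measurable U) (hUfin : ∀ x, U x ≠ ⊤) {φ : X → A} (hφ : Measurable φ)
    {g : ℝ≥0∞} (h : ∀ x, bellman M C U x (φ x) ≤ g + U x) : avgInf M C ≤ g := by
  obtain ⟨x⟩ := ‹Nonempty X›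
  refine (iInf₂_le x (detPolicy φ hφ)).trans ?_
  have hle : ∀ᶠ N : ℕ in atTop,
      (N : ℝ≥0∞)⁻¹ * ∑ t ∈ Finset.range N, stepCost M C (detPolicy φ hφ) x t
        ≤ g + (N : ℝ≥0∞)⁻¹ * U x := by
    filter_upwards [eventually_gt_atTop 0] with N hN
    have hN0 : (N : ℝ≥0∞) ≠ 0 := by exact_mod_cast hN.ne'
    have := le_self_add.trans (sum_stepCost_detPolicy_le_add hC hU hφ h x N)
    refine (mul_le_mul_right this _).trans (le_of_eq ?_)
    rw [mul_add, ← mul_assoc, ENNReal.inv_mul_cancel hN0 (ENNReal.natCast_ne_top N), one_mul]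
  refine (limsup_le_limsup hle).trans (le_of_eq (Tendsto.limsup_eq ?_))
  have := (tendsto_const_nhds (x := g)).add
    (ENNReal.Tendsto.mul_const ENNReal.tendsto_inv_nat_nhds_zero (Or.inr (hUfin x)))
  simpa using this

theorem limsup_one_sub_mul_iInf_discOpt_le {α : ℕ → ℝ≥0∞} (hlt : ∀ n, α n < 1)
    (hα : Tendsto α atTop (𝓝 1)) :
    limsup (fun n => (1 - α n) * ⨅ y, discOpt M C (α n) y) atTop ≤ avgInf M C := by
  refine le_iInf₂ fun x p => le_trans ?_ (limsup_one_sub_mul_tsum_le hα hlt (stepCost M C p x))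
  refine limsup_le_limsup (Eventually.of_forall fun n => ?_)
  exact mul_le_mul_right ((iInf_le _ x).trans (iInf_le _ p)) _

variable [StandardBorelSpace X] [MetricSpace A] [TopologicalSpace.SeparableSpace A] [BorelSpace A]
  [StandardBorelSpace A]

theorem measurable_relValue [Nonempty A] (hC : Measurable fun p : X × A => C p.1 p.2)
    (hCc : ∀ x r, r ≠ ⊤ → IsCompact {b | C x b ≤ r})
    (hq : ∀ x, ∀ B : Set X, MeasurableSet B → Continuous fun b : A => M.q (x, b) B) (β : ℝ≥0∞) :
    Measurable (relValue M C β) :=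
  (measurable_discOpt_and_eq_iInf_bellman hC hCc hq).1.sub measurable_const

/-- The optimality equation for the discounted relative value function. -/
theorem one_sub_mul_add_relValue [Nonempty A] (hC : Measurable fun p : X × A => C p.1 p.2)
    (hCc : ∀ x r, r ≠ ⊤ → IsCompact {b | C x b ≤ r})
    (hq : ∀ x, ∀ B : Set X, MeasurableSet B → Continuous fun b : A => M.q (x, b) B)
    {β : ℝ≥0∞} (hβ : β ≤ 1) (hm : ⨅ y, discOpt M C β y ≠ ⊤) (x : X) :
    (1 - β) * (⨅ y, discOpt M C β y) + relValue M C β x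
      = ⨅ b, bellman M C (fun y => β * relValue M C β y) x b := by
  have hV := (measurable_discOpt_and_eq_iInf_bellman (β := β) hC hCc hq).2 x
  set m := ⨅ y, discOpt M C β y with hmdef
  have hadd : ∀ y, discOpt M C β y = m + relValue M C β y := fun y =>
    (add_tsub_cancel_of_le (iInf_le _ y)).symm
  have hbell : ∀ b, bellman M C (fun y => β * discOpt M C β y) x b
      = β * m + bellman M C (fun y => β * relValue M C β y) x b := by
    intro b
    simp_rw [bellman, hadd, mul_add]
    rw [lintegral_add_left measurable_const, lintegral_const, measure_univ, mul_one,
      add_left_comm]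
  rw [hadd] at hV
  simp_rw [hbell] at hV
  rw [← ENNReal.add_iInf] at hV
  refine (ENNReal.add_right_inj (ENNReal.mul_ne_top (ne_top_of_le_ne_top ENNReal.one_ne_top hβ) hm)).1
    (Eq.trans ?_ hV)
  rw [← add_assoc, ← add_mul, add_tsub_cancel_of_le hβ, one_mul]

theorem exists_bellman_le_liminf_add [Nonempty A] (hC : Measurable fun p : X × A => C p.1 p.2)
    (hCc : ∀ x r, r ≠ ⊤ → IsCompact {b | C x b ≤ r})
    (hq : ∀ x, ∀ B : Set X, MeasurableSet B → Continuous fun b : A => M.q (x, b) B)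
    {α : ℕ → ℝ≥0∞} (hmono : Monotone α) (hlt : ∀ n, α n < 1) (hα : Tendsto α atTop (𝓝 1))
    (hm : ∀ n, ⨅ y, discOpt M C (α n) y ≠ ⊤) {U : X → ℝ≥0∞}
    (hlim : ∀ x, Tendsto (fun n => relValue M C (α n) x) atTop (𝓝 (U x))) (x : X) :
    ∃ b, bellman M C U x b
      ≤ liminf (fun n => (1 - α n) * ⨅ y, discOpt M C (α n) y) atTop + U x := by
  let W : ℕ → X → ℝ≥0∞ := fun k y => α k * ⨅ n, relValue M C (α (n + k)) y
  have hWm : ∀ k, Measurable (W k) := fun k =>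
    (Measurable.iInf fun n => measurable_relValue hC hCc hq _).const_mul _
  have hinf : ∀ y, Monotone fun k => ⨅ n, relValue M C (α (n + k)) y := by
    intro y i j hij
    refine le_iInf fun n => (iInf_le _ (n + (j - i))).trans (le_of_eq ?_)
    rw [add_assoc, Nat.sub_add_cancel hij]
  have hWmono : Monotone W := fun i j hij y => mul_le_mul' (hmono hij) (hinf y hij)
  have hUle : ∀ y, U y ≤ ⨆ k, W k y := by
    intro y
    have h1 := tendsto_atTop_iSup (hinf y)
    rw [← liminf_eq_iSup_iInf_of_nat' (u := fun n => relValue M C (α n) y), (hlim y).liminf_eq] at h1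
    have h2 := ENNReal.Tendsto.mul hα (Or.inl one_ne_zero) h1 (Or.inr ENNReal.one_ne_top)
    rw [one_mul] at h2
    exact le_of_tendsto' h2 fun k => le_iSup (fun k => W k y) k
  obtain ⟨b, hb⟩ := exists_bellman_iSup_le (M := M) (C := C) (x := x)
    (L := liminf (fun n => (1 - α n) * ⨅ y, discOpt M C (α n) y) atTop + U x)
    hCc hq hWm hWmono fun k => by
      rw [add_comm]
      refine le_add_liminf_of_tendsto (hlim x) ?_
      filter_upwards [eventually_ge_atTop k] with n hn
      rw [add_comm, one_sub_mul_add_relValue hC hCc hq (hlt n).le (hm n)]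
      refine iInf_mono fun b => bellman_mono (fun y => ?_) x b
      refine mul_le_mul' (hmono hn) ((iInf_le _ (n - k)).trans (le_of_eq ?_))
      rw [Nat.sub_add_cancel hn]
  exact ⟨b, (bellman_mono hUle x b).trans hb⟩

/-- The average-cost optimality equation for nonnegative cost functions. -/
theorem exists_bellman_eq_avgInf_add [Nonempty X] [Nonempty A]
    (hC : Measurable fun p : X × A => C p.1 p.2)
    (hCc : ∀ x r, r ≠ ⊤ → IsCompact {b | C x b ≤ r})
    (hq : ∀ x, ∀ B : Set X, MeasurableSet B → Continuous fun b : A => M.q (x, b) B)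
    {α : ℕ → ℝ≥0∞} (hmono : Monotone α) (hlt : ∀ n, α n < 1) (hα : Tendsto α atTop (𝓝 1))
    (hm : ∀ n, ⨅ y, discOpt M C (α n) y ≠ ⊤) {U : X → ℝ≥0∞} (hUfin : ∀ x, U x ≠ ⊤)
    (hlim : ∀ x, Tendsto (fun n => relValue M C (α n) x) atTop (𝓝 (U x)))
    (hui : ∀ x b, Tendsto (fun K : ℕ => limsup (fun n =>
      ∫⁻ y in {y | (K : ℝ≥0∞) ≤ relValue M C (α n) y}, relValue M C (α n) y ∂M.q (x, b)) atTop)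
      atTop (𝓝 0)) :
    ∃ φ : X → A, Measurable φ ∧ ∀ x, bellman M C U x (φ x) = avgInf M C + U x ∧
      bellman M C U x (φ x) = ⨅ b, bellman M C U x b := by
  have hu := fun n => measurable_relValue hC hCc hq (α n)
  have hU : Measurable U := measurable_of_tendsto_metrizable hu (tendsto_pi_nhds.2 hlim)
  obtain ⟨φ, hφ, hmin⟩ := exists_measurable_argmin (measurable_bellman (M := M) hC hU)
    (isCompact_bellman_le hCc hq hU)
  have hlow : ∀ x, bellman M C U x (φ x)
      ≤ liminf (fun n => (1 - α n) * ⨅ y, discOpt M C (α n) y) atTop + U x := fun x => by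
    obtain ⟨b, hb⟩ := exists_bellman_le_liminf_add hC hCc hq hmono hlt hα hm hlim x
    exact (hmin x).trans_le ((iInf_le _ b).trans hb)
  have hle := avgInf_le_of_bellman_le hC hU hUfin hφ hlow
  have hsup := limsup_one_sub_mul_iInf_discOpt_le (M := M) (C := C) hlt hα
  have hρ := tendsto_of_le_liminf_of_limsup_le hle hsup
  refine ⟨φ, hφ, fun x => ⟨le_antisymm ?_ ?_, hmin x⟩⟩
  · rw [← hρ.liminf_eq]
    exact hlow x
  · refine le_add_lintegral_of_asymptotically_uniformIntegrable hu hlim (hui x (φ x))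
      (hρ.add (hlim x)) fun n => ?_
    rw [one_sub_mul_add_relValue hC hCc hq (hlt n).le (hm n)]
    refine (iInf_le _ (φ x)).trans (bellman_mono (fun y => ?_) x (φ x))
    exact mul_le_of_le_one_left' (hlt n).le

end VanishingDiscount

section ERealShift

/-- Difference of extended nonnegative reals, computed in the extended reals. -/
def ediff (r y : ℝ≥0∞) : EReal := (y : EReal) - (r : EReal)

variable {r : ℝ≥0∞}

theorem eToENN_eq_toENNReal (x : EReal) : eToENN x = x.toENNReal := rfl

theorem eToENN_coe (y : ℝ≥0∞) : eToENN (y : EReal) = y := EReal.toENNReal_coe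

theorem ediff_top (hr : r ≠ ⊤) : ediff r ⊤ = ⊤ := by
  lift r to ℝ≥0 using hr
  rfl

theorem monotone_ediff : Monotone (ediff r) := fun _ _ h =>
  EReal.sub_le_sub (EReal.coe_ennreal_le_coe_ennreal_iff.2 h) le_rfl

theorem continuous_ediff (hr : r ≠ ⊤) : Continuous (ediff r) := by
  lift r to ℝ≥0 using hr
  refine continuous_iff_continuousAt.2 fun y => ?_
  refine Tendsto.comp (y := 𝓝 ((y : EReal), -((r : ℝ≥0∞) : EReal)))
    (EReal.continuousAt_add (Or.inr ?_) (Or.inl (EReal.coe_ennreal_ne_bot _)))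
    ((continuous_coe_ennreal_ereal.tendsto y).prodMk_nhds tendsto_const_nhds)
  simp

theorem ediff_iInf {ι : Sort*} (hr : r ≠ ⊤) (f : ι → ℝ≥0∞) :
    ediff r (⨅ i, f i) = ⨅ i, ediff r (f i) :=
  monotone_ediff.map_iInf_of_continuousAt (continuous_ediff hr).continuousAt (ediff_top hr)

theorem ediff_limsup (hr : r ≠ ⊤) (f : ℕ → ℝ≥0∞) :
    ediff r (limsup f atTop) = limsup (fun n => ediff r (f n)) atTop :=
  monotone_ediff.map_limsup_of_continuousAt f (continuous_ediff hr).continuousAt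

theorem ediff_add (y z : ℝ≥0∞) : ediff r y + z = ediff r (y + z) := by
  rw [ediff, ediff, EReal.coe_ennreal_add, sub_eq_add_neg, sub_eq_add_neg, add_right_comm]

theorem ediff_add_ediff {s : ℝ≥0∞} (hr : r ≠ ⊤) (y z : ℝ≥0∞) :
    ediff r y + ediff s z = ediff (r + s) (y + z) := by
  lift r to ℝ≥0 using hr
  simp only [ediff, EReal.coe_ennreal_add, sub_eq_add_neg]
  rw [EReal.neg_add (by simp) (by simp), sub_eq_add_neg, add_add_add_comm]

theorem coe_mul_ediff {c : ℝ≥0∞} (hc : c ≠ ⊤) (y : ℝ≥0∞) :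
    (c : EReal) * ediff r y = ediff (c * r) (c * y) := by
  rw [ediff, ediff, EReal.coe_ennreal_mul, EReal.coe_ennreal_mul,
    EReal.mul_sub_of_nonneg_of_ne_top (EReal.coe_ennreal_nonneg c) (by simpa using hc)]

theorem ediff_sub_ediff (hr : r ≠ ⊤) {y z : ℝ≥0∞} (hz : z ≠ ⊤) (hzy : z ≤ y) :
    ediff r y - ediff r z = ((y - z : ℝ≥0∞) : EReal) := by
  obtain ⟨w, rfl⟩ := le_iff_exists_add.1 hzy
  rw [ENNReal.add_sub_cancel_left hz]
  lift r to ℝ≥0 using hr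
  lift z to ℝ≥0 using hz
  induction w with
  | top => rfl
  | coe w =>
    have h : ∀ s t : ℝ≥0, ediff s t = ((t - s : ℝ) : EReal) := fun _ _ => rfl
    rw [← ENNReal.coe_add, h, h, ← EReal.coe_sub]
    change _ = ((w : ℝ) : EReal)
    congr 1
    push_cast
    ring

theorem ediff_sub_ediff_top (hr : r ≠ ⊤) (y : ℝ≥0∞) : ediff r y - ediff r ⊤ = ⊥ := by
  rw [ediff_top hr, sub_eq_add_neg, EReal.neg_top, EReal.add_bot]

theorem ediff_eq_ediff_of_add_eq {p n b : ℝ≥0∞} (hn : n ≠ ⊤) (hr : r ≠ ⊤) (h : p + r = b + n) :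
    ediff n p = ediff r b := by
  lift r to ℝ≥0 using hr
  lift n to ℝ≥0 using hn
  induction p with
  | top =>
    have : b = ⊤ := by simpa using h.symm
    rw [this, ediff_top ENNReal.coe_ne_top, ediff_top ENNReal.coe_ne_top]
  | coe p =>
    induction b with
    | top => simp [← ENNReal.coe_add] at h
    | coe b =>
      have h' : ∀ s t : ℝ≥0, ediff s t = ((t - s : ℝ) : EReal) := fun _ _ => rfl
      have h2 : p + r = b + n := by exact_mod_cast h
      have h3 : (p : ℝ) + r = b + n := by exact_mod_cast h2
      rw [h', h']
      congr 1
      linarith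

theorem eInt_ediff {Y : Type*} [MeasurableSpace Y] {μ : Measure Y} {κ b : Y → ℝ≥0∞}
    (hb : Measurable b) (hκ : Measurable κ) (hκfin : ∀ y, κ y ≠ ⊤) (hfin : ∫⁻ y, κ y ∂μ ≠ ⊤) :
    eInt μ (fun y => ediff (κ y) (b y)) = ediff (∫⁻ y, κ y ∂μ) (∫⁻ y, b y ∂μ) := by
  have hpos : ∀ y, eToENN (ediff (κ y) (b y)) = b y - κ y := fun y => by
    rw [eToENN_eq_toENNReal, ediff, EReal.toENNReal_sub (EReal.coe_ennreal_nonneg _),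
      EReal.toENNReal_coe, EReal.toENNReal_coe]
  have hneg : ∀ y, eToENN (-ediff (κ y) (b y)) = κ y - b y := fun y => by
    rw [eToENN_eq_toENNReal, ediff, EReal.neg_sub (Or.inl (EReal.coe_ennreal_ne_bot _))
      (Or.inr (by simpa using hκfin y)), add_comm, ← sub_eq_add_neg,
      EReal.toENNReal_sub (EReal.coe_ennreal_nonneg _), EReal.toENNReal_coe, EReal.toENNReal_coe]
  simp only [eInt, hpos, hneg]
  refine ediff_eq_ediff_of_add_eq
    (ne_top_of_le_ne_top hfin (lintegral_mono fun y => tsub_le_self)) hfin ?_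
  rw [← lintegral_add_right _ hκ, ← lintegral_add_left hb]
  refine lintegral_congr fun y => ?_
  rw [tsub_add_eq_max, add_tsub_eq_max]

theorem eInt_coe {Y : Type*} [MeasurableSpace Y] (μ : Measure Y) (b : Y → ℝ≥0∞) :
    eInt μ (fun y => (b y : EReal)) = ((∫⁻ y, b y ∂μ : ℝ≥0∞) : EReal) := by
  have : ∀ y, eToENN (-(b y : EReal)) = 0 := fun y =>
    EReal.toENNReal_of_nonpos (by simp [EReal.coe_ennreal_nonneg])
  simp only [eInt, eToENN_coe, this]
  simp

theorem eSum_ediff {κ b : ℕ → ℝ≥0∞} (hκ : ∑' t, κ t ≠ ⊤) :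
    eSum (fun t => ediff (κ t) (b t)) = ediff (∑' t, κ t) (∑' t, b t) := by
  have := eInt_ediff (μ := Measure.count) (measurable_of_countable b) (measurable_of_countable κ)
    (ENNReal.ne_top_of_tsum_ne_top hκ) (by rwa [lintegral_count])
  simpa only [eInt, eSum, lintegral_count] using this

end ERealShift

section Translation

variable {X A : Type*} [MeasurableSpace X] [MeasurableSpace A] {M : MDP X A}
  {C : X → A → ℝ≥0∞} {κ : ℝ≥0∞}

theorem expCost_eq_ediff (hC : Measurable fun p : X × A => C p.1 p.2) (hκ : κ ≠ ⊤)
    (hc : ∀ x b, M.c x b = ediff κ (C x b)) (p : Policy X A) (x : X) (t : ℕ) :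
    expCost M p x t = ediff κ (stepCost M C p x t) := by
  simp only [expCost, hc]
  rw [eInt_ediff (κ := fun _ => κ) (b := fun z : X × A => C z.1 z.2) hC measurable_const
    (fun _ => hκ) (by simpa using hκ), stepCost]
  simp

theorem inv_one_sub_mul_ne_top (hκ : κ ≠ ⊤) {α : ℝ} (hα : α ∈ Ico (0 : ℝ) 1) :
    (1 - ENNReal.ofReal α)⁻¹ * κ ≠ ⊤ :=
  ENNReal.mul_ne_top
    (ENNReal.inv_ne_top.2 (tsub_pos_of_lt (ENNReal.ofReal_lt_one.2 hα.2)).ne') hκ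

theorem vDisc_eq_ediff (hC : Measurable fun p : X × A => C p.1 p.2) (hκ : κ ≠ ⊤)
    (hc : ∀ x b, M.c x b = ediff κ (C x b)) {α : ℝ} (hα : α ∈ Ico (0 : ℝ) 1) (p : Policy X A)
    (x : X) : vDisc M α p x = ediff ((1 - ENNReal.ofReal α)⁻¹ * κ)
      (∑' t, ENNReal.ofReal α ^ t * stepCost M C p x t) := by
  have hpow : ∀ t, ((α ^ t : ℝ) : EReal) = ((ENNReal.ofReal α ^ t : ℝ≥0∞) : EReal) := fun t => by
    rw [← ENNReal.ofReal_pow hα.1, EReal.coe_ennreal_ofReal, max_eq_left (pow_nonneg hα.1 t)]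
  have hsum : ∑' t : ℕ, ENNReal.ofReal α ^ t * κ = (1 - ENNReal.ofReal α)⁻¹ * κ := by
    rw [ENNReal.tsum_mul_right, ENNReal.tsum_geometric]
  have hterm : ∀ t, ((α ^ t : ℝ) : EReal) * expCost M p x t
      = ediff (ENNReal.ofReal α ^ t * κ) (ENNReal.ofReal α ^ t * stepCost M C p x t) := fun t => by
    rw [hpow, expCost_eq_ediff hC hκ hc,
      coe_mul_ediff (ENNReal.pow_ne_top ENNReal.ofReal_ne_top)]
  simp only [vDisc, hterm]
  rw [eSum_ediff (by rw [hsum]; exact inv_one_sub_mul_ne_top hκ hα), hsum]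

theorem vDiscOpt_eq_ediff (hC : Measurable fun p : X × A => C p.1 p.2) (hκ : κ ≠ ⊤)
    (hc : ∀ x b, M.c x b = ediff κ (C x b)) {α : ℝ} (hα : α ∈ Ico (0 : ℝ) 1) (x : X) :
    vDiscOpt M α x
      = ediff ((1 - ENNReal.ofReal α)⁻¹ * κ) (discOpt M C (ENNReal.ofReal α) x) := by
  rw [discOpt, ediff_iInf (inv_one_sub_mul_ne_top hκ hα)]
  exact iInf_congr fun p => vDisc_eq_ediff hC hκ hc hα p x

theorem mDisc_eq_ediff (hC : Measurable fun p : X × A => C p.1 p.2) (hκ : κ ≠ ⊤)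
    (hc : ∀ x b, M.c x b = ediff κ (C x b)) {α : ℝ} (hα : α ∈ Ico (0 : ℝ) 1) :
    mDisc M α
      = ediff ((1 - ENNReal.ofReal α)⁻¹ * κ) (⨅ x, discOpt M C (ENNReal.ofReal α) x) := by
  rw [ediff_iInf (inv_one_sub_mul_ne_top hκ hα)]
  exact iInf_congr fun x => vDiscOpt_eq_ediff hC hκ hc hα x

theorem uDisc_eq_relValue (hC : Measurable fun p : X × A => C p.1 p.2) (hκ : κ ≠ ⊤)
    (hc : ∀ x b, M.c x b = ediff κ (C x b)) {α : ℝ} (hα : α ∈ Ico (0 : ℝ) 1)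
    (hm : ⨅ x, discOpt M C (ENNReal.ofReal α) x ≠ ⊤) (x : X) :
    uDisc M α x = ((relValue M C (ENNReal.ofReal α) x : ℝ≥0∞) : EReal) := by
  rw [uDisc, vDiscOpt_eq_ediff hC hκ hc hα, mDisc_eq_ediff hC hκ hc hα,
    ediff_sub_ediff (inv_one_sub_mul_ne_top hκ hα) hm (iInf_le _ x), relValue]

theorem iInf_discOpt_ne_top_of_uDisc_ne_bot (hC : Measurable fun p : X × A => C p.1 p.2)
    (hκ : κ ≠ ⊤) (hc : ∀ x b, M.c x b = ediff κ (C x b)) {α : ℝ} (hα : α ∈ Ico (0 : ℝ) 1) {x : X}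
    (hx : uDisc M α x ≠ ⊥) : ⨅ x, discOpt M C (ENNReal.ofReal α) x ≠ ⊤ := by
  intro h
  rw [uDisc, vDiscOpt_eq_ediff hC hκ hc hα, mDisc_eq_ediff hC hκ hc hα, h,
    ediff_sub_ediff_top (inv_one_sub_mul_ne_top hκ hα)] at hx
  exact hx rfl

theorem vFin_eq_ediff (hC : Measurable fun p : X × A => C p.1 p.2) (hκ : κ ≠ ⊤)
    (hc : ∀ x b, M.c x b = ediff κ (C x b)) (p : Policy X A) (x : X) (N : ℕ) :
    vFin M N p x = ediff (N * κ) (∑ t ∈ Finset.range N, stepCost M C p x t) := by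
  induction N with
  | zero => simp [vFin, ediff]
  | succ N ih =>
    have h := ih
    rw [vFin] at h ⊢
    rw [Finset.sum_range_succ, Finset.sum_range_succ, h, expCost_eq_ediff hC hκ hc,
      ediff_add_ediff (ENNReal.mul_ne_top (ENNReal.natCast_ne_top N) hκ)]
    congr 1
    push_cast
    ring

theorem avgCost_eq_ediff (hC : Measurable fun p : X × A => C p.1 p.2) (hκ : κ ≠ ⊤)
    (hc : ∀ x b, M.c x b = ediff κ (C x b)) (p : Policy X A) (x : X) :
    avgCost M p x = ediff κ (limsup
      (fun N : ℕ => (N : ℝ≥0∞)⁻¹ * ∑ t ∈ Finset.range N, stepCost M C p x t) atTop) := by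
  rw [ediff_limsup hκ, avgCost]
  refine limsup_congr ?_
  filter_upwards [eventually_gt_atTop 0] with N hN
  have hN0 : (N : ℝ≥0∞) ≠ 0 := by exact_mod_cast hN.ne'
  have hinv : (((N : ℝ)⁻¹ : ℝ) : EReal) = (((N : ℝ≥0∞)⁻¹ : ℝ≥0∞) : EReal) := by
    rw [← ENNReal.ofReal_natCast, ← ENNReal.ofReal_inv_of_pos (by exact_mod_cast hN),
      EReal.coe_ennreal_ofReal, max_eq_left (by positivity)]
  rw [hinv, vFin_eq_ediff hC hκ hc, coe_mul_ediff (ENNReal.inv_ne_top.2 hN0), ← mul_assoc,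
    ENNReal.inv_mul_cancel hN0 (ENNReal.natCast_ne_top N), one_mul]

theorem wStar_eq_ediff (hC : Measurable fun p : X × A => C p.1 p.2) (hκ : κ ≠ ⊤)
    (hc : ∀ x b, M.c x b = ediff κ (C x b)) : wStar M = ediff κ (avgInf M C) := by
  rw [avgInf, ediff_iInf hκ]
  refine iInf_congr fun x => ?_
  rw [ediff_iInf hκ]
  exact iInf_congr fun p => avgCost_eq_ediff hC hκ hc p x

theorem nonempty_of_wStar_lt_top (h : wStar M < ⊤) : Nonempty X ∧ Nonempty A := by
  obtain ⟨x, hx⟩ := iInf_lt_iff.1 h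
  obtain ⟨p, -⟩ := iInf_lt_iff.1 hx
  have := p.markov 0
  exact ⟨⟨x⟩, nonempty_of_isProbabilityMeasure (p.π 0 (Fin.elim0, x))⟩

variable (M) in
/-- A cost function bounded below is a nonnegative cost function minus a constant. -/
theorem exists_eq_ediff : ∃ (C : X → A → ℝ≥0∞) (κ : ℝ≥0∞), κ ≠ ⊤ ∧
    (Measurable fun p : X × A => C p.1 p.2) ∧ ∀ x b, M.c x b = ediff κ (C x b) := by
  obtain ⟨K, hK⟩ := M.c_ne_bot
  refine ⟨fun x b => (M.c x b + (ENNReal.ofReal (-K) : ℝ≥0∞)).toENNReal, ENNReal.ofReal (-K),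
    ENNReal.ofReal_ne_top, (M.c_meas.add measurable_const).ereal_toENNReal, fun x b => ?_⟩
  have hnonneg : 0 ≤ M.c x b + (ENNReal.ofReal (-K) : ℝ≥0∞) := by
    refine le_trans ?_ (add_le_add_left (hK x b) _)
    rw [EReal.coe_ennreal_ofReal, ← EReal.coe_add]
    have := le_max_left (-K) 0
    exact_mod_cast (by linarith : 0 ≤ K + max (-K) 0)
  rw [ediff, EReal.coe_toENNReal hnonneg, EReal.coe_ennreal_ofReal, EReal.add_sub_cancel_right]

theorem isCompact_setOf_le_of_eq_ediff [TopologicalSpace A] (hκ : κ ≠ ⊤)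
    (hc : ∀ x b, M.c x b = ediff κ (C x b))
    (hS : ∀ x : X, ∀ lam : ℝ, IsCompact {b : A | M.c x b ≤ (lam : EReal)}) (x : X) (r : ℝ≥0∞)
    (hr : r ≠ ⊤) : IsCompact {b | C x b ≤ r} := by
  lift r to ℝ≥0 using hr
  lift κ to ℝ≥0 using hκ
  refine (congrArg IsCompact ?_).mp (hS x (r - κ))
  ext b
  change M.c x b ≤ ((r - κ : ℝ) : EReal) ↔ C x b ≤ r
  rw [hc, ediff, EReal.sub_le_iff_le_add (by simp) (by simp), ← EReal.coe_ennreal_le_coe_ennreal_iff]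
  change _ ≤ ((r - κ : ℝ) : EReal) + ((κ : ℝ) : EReal) ↔ _
  rw [← EReal.coe_add, sub_add_cancel]
  rfl

end Translation

/-- Theorem 3.11. Under Assumptions S*, B̲_{{α_n}}, LEC_{{α_n}}(ii) and
LEC_{{α_n}}(iii), there is a deterministic policy `φ` such that the ACOE holds with
`u(x) := lim_{n→∞} u_{α_n}(x)`: for all `x`,
`w* + u(x) = c(x,φ(x)) + ∫ u dq(·|x,φ(x)) = min_{a∈A} [c(x,a) + ∫ u dq(·|x,a)]`. -/
theorem statement6
    (M : MDP X A)
    (hS1 : AssumptionSi M) (hS2 : AssumptionSii M)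
    (a : ℕ → ℝ)
    (ha : ∀ n, a n ∈ Set.Ico (0 : ℝ) 1) (hamono : Monotone a)
    (hatend : Tendsto a atTop (𝓝 (1 : ℝ)))
    (hB1 : wStar M < ⊤)
    (hB2 : ∀ x, Filter.liminf (fun n => uDisc M (a n) x) atTop < ⊤)
    (hLEC2 : ∀ x : X, ∃ L : ℝ,
      Tendsto (fun n : ℕ => uDisc M (a n) x) atTop (𝓝 (L : EReal)))
    (hLEC3 : ∀ x : X, ∀ b : A,
      Tendsto (fun K : ℝ => Filter.limsup (fun n : ℕ =>
          ∫⁻ y in {y : X | (K : EReal) ≤ uDisc M (a n) y},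
            eToENN (uDisc M (a n) y) ∂ (M.q (x, b))) atTop)
        atTop (𝓝 (0 : ℝ≥0∞))) :
    ∃ (φ : X → A) (_ : Measurable φ), ∀ x : X,
      wStar M + uPointwise M a x
        = M.c x (φ x) + eInt (M.q (x, φ x)) (uPointwise M a)
      ∧ M.c x (φ x) + eInt (M.q (x, φ x)) (uPointwise M a)
        = ⨅ b : A, (M.c x b + eInt (M.q (x, b)) (uPointwise M a)) := by
  obtain ⟨hX, hA⟩ := nonempty_of_wStar_lt_top hB1
  obtain ⟨C, κ, hκ, hC, hc⟩ := exists_eq_ediff M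
  have hCc := isCompact_setOf_le_of_eq_ediff hκ hc hS1
  choose L hL using hLEC2
  have hmEv : ∀ᶠ n in atTop, ⨅ y, discOpt M C (ENNReal.ofReal (a n)) y ≠ ⊤ := by
    filter_upwards [(hL hX.some).eventually_ne (EReal.coe_ne_bot _)] with n hn
    exact iInf_discOpt_ne_top_of_uDisc_ne_bot hC hκ hc (ha n) hn
  obtain ⟨N, hN⟩ := eventually_atTop.1 hmEv
  have hm : ∀ n, ⨅ y, discOpt M C (ENNReal.ofReal (a (n + N))) y ≠ ⊤ := fun n =>
    hN _ (Nat.le_add_left _ _)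
  have hu : ∀ n y, uDisc M (a (n + N)) y
      = ((relValue M C (ENNReal.ofReal (a (n + N))) y : ℝ≥0∞) : EReal) := fun n y =>
    uDisc_eq_relValue hC hκ hc (ha _) (hm n) y
  have hLN : ∀ x, Tendsto (fun n => uDisc M (a (n + N)) x) atTop (𝓝 (L x : EReal)) := fun x =>
    (hL x).comp (tendsto_add_atTop_nat N)
  have hL0 : ∀ x, 0 ≤ L x := fun x => by
    refine EReal.coe_nonneg.1 (ge_of_tendsto' (hLN x) fun n => ?_)
    rw [hu]
    exact EReal.coe_ennreal_nonneg _
  have hU : ∀ x, uPointwise M a x = ((ENNReal.ofReal (L x) : ℝ≥0∞) : EReal) := fun x => by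
    rw [uPointwise, (hL x).liminf_eq, EReal.coe_ennreal_ofReal, max_eq_left (hL0 x)]
  have hlim : ∀ x, Tendsto (fun n => relValue M C (ENNReal.ofReal (a (n + N))) x) atTop
      (𝓝 (ENNReal.ofReal (L x))) := fun x => by
    rw [← EReal.tendsto_coe_ennreal, EReal.coe_ennreal_ofReal, max_eq_left (hL0 x)]
    simpa only [hu] using hLN x
  have hui : ∀ x b, Tendsto (fun K : ℕ => limsup (fun n =>
      ∫⁻ y in {y | (K : ℝ≥0∞) ≤ relValue M C (ENNReal.ofReal (a (n + N))) y},
        relValue M C (ENNReal.ofReal (a (n + N))) y ∂M.q (x, b)) atTop) atTop (𝓝 0) := by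
    intro x b
    refine ((hLEC3 x b).comp tendsto_natCast_atTop_atTop).congr fun K => ?_
    rw [Function.comp_apply, ← limsup_nat_add _ N]
    have hcast : (((K : ℕ) : ℝ) : EReal) = ((K : ℝ≥0∞) : EReal) := by
      rw [← ENNReal.ofReal_natCast, EReal.coe_ennreal_ofReal, max_eq_left K.cast_nonneg]
    simp only [hu, eToENN_coe, hcast, EReal.coe_ennreal_le_coe_ennreal_iff]
  have htend : Tendsto (fun n => ENNReal.ofReal (a (n + N))) atTop (𝓝 1) := by
    rw [← ENNReal.ofReal_one]
    exact ENNReal.tendsto_ofReal (hatend.comp (tendsto_add_atTop_nat N))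
  obtain ⟨φ, hφ, h⟩ := exists_bellman_eq_avgInf_add (M := M) hC hCc hS2
    (fun i j hij => ENNReal.ofReal_le_ofReal (hamono (Nat.add_le_add_right hij N)))
    (fun n => ENNReal.ofReal_lt_one.2 (ha _).2) htend hm (fun x => ENNReal.ofReal_ne_top) hlim hui
  have hval : ∀ x b, M.c x b + eInt (M.q (x, b)) (uPointwise M a)
      = ediff κ (bellman M C (fun y => ENNReal.ofReal (L y)) x b) := by
    intro x b
    rw [funext hU, eInt_coe, hc, ediff_add, bellman]
  refine ⟨φ, hφ, fun x => ?_⟩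
  simp only [hval]
  rw [hU, wStar_eq_ediff hC hκ hc, ediff_add, ← (h x).1, ← ediff_iInf hκ, ← (h x).2]
  exact ⟨rfl, rfl⟩

end Statements

end
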